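/- arXiv:1603.02367 — 2 statements merged into one kernel-verified Lean document; each statement's English description precedes it below -/
import Mathlib

section
/- Under Assumption ALB, P̄ is the minimal function P in 𝒫̂ satisfying, for all u ∈ [T0,T1), t ∈ (u,T1), x ∈ X, and all Borel B ⊆ X, the integral equation (IE) P(u,x;t,B) = 1_B(x)·exp(−∫_u^t q(x,θ)dθ) + ∫_u^t ∫_X ∫_B exp(−∫_w^t q(y,θ)dθ) q⁺(z,w,dy) P(u,x;w,dz) dw. In addition, if P̄ is regular (P̄(u,x;t,X) = 1 for all u,x,t), then P̄ is the unique function in 𝒫̂ with values in [0,1] satisfying (IE) for all u,t,x,B. -/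
open MeasureTheory Set Filter

/-- `∫_a^b q(x,θ) dθ` (Lebesgue integral over the open interval). -/
noncomputable def qInt {X : Type*} (q : X → ℝ → ℝ) (x : X) (a b : ℝ) : ℝ :=
  ∫ θ in Set.Ioo a b, q x θ

/-- The Feller iterates `P̄⁽ⁿ⁾(u,x;t,·)`, as measures on `X`. -/
noncomputable def PbarM {X : Type*} [MeasurableSpace X]
    (q : X → ℝ → ℝ) (qp : X → ℝ → Measure X) :
    ℕ → ℝ → X → ℝ → Measure X
  | 0, u, x, t => ENNReal.ofReal (Real.exp (-(qInt q x u t))) • Measure.dirac x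
  | n + 1, u, x, t =>
      (volume.restrict (Set.Ioo u t)).bind fun w =>
        (ENNReal.ofReal (Real.exp (-(qInt q x u w))) • qp x w).bind fun y =>
          PbarM q qp n w y t

/-- `P̄(u,x;t,·) = Σ_n P̄⁽ⁿ⁾(u,x;t,·)`. -/
noncomputable def PbarMeas {X : Type*} [MeasurableSpace X]
    (q : X → ℝ → ℝ) (qp : X → ℝ → Measure X) (u : ℝ) (x : X) (t : ℝ) : Measure X :=
  Measure.sum fun n => PbarM q qp n u x t

/-- Classical (ε-δ) absolute continuity of a real function on a set. -/
def AbsContOn (f : ℝ → ℝ) (s : Set ℝ) : Prop :=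
  ∀ ε > (0:ℝ), ∃ δ > (0:ℝ), ∀ n : ℕ, ∀ a b : ℕ → ℝ,
    (∀ i < n, a i ∈ s ∧ b i ∈ s ∧ a i ≤ b i) →
    (∀ i < n, ∀ j < n, i ≠ j → Disjoint (Set.Ioo (a i) (b i)) (Set.Ioo (a j) (b j))) →
    (∑ i ∈ Finset.range n, (b i - a i)) < δ →
    (∑ i ∈ Finset.range n, |f (b i) - f (a i)|) < ε

/-- `B` is a `(q,s)`-bounded set: `q` is bounded on `B × [T0,s)`. -/
def QBddOn {X : Type*} [MeasurableSpace X] (q : X → ℝ → ℝ) (T0 : ℝ) (s : EReal)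
    (B : Set X) : Prop :=
  MeasurableSet B ∧ ∃ M : ℝ, ∀ x ∈ B, ∀ t : ℝ, T0 ≤ t → (t : EReal) < s → q x t ≤ M

/-- The interval `(u,T1)` inside `ℝ`, where `T1` may be `+∞`. -/
def IooE (u : ℝ) (T1 : EReal) : Set ℝ := {r : ℝ | u < r ∧ (r : EReal) < T1}

/-- Membership in the family `𝒫̂`. -/
def MemPhat {X : Type*} [MeasurableSpace X] (T0 : ℝ) (T1 : EReal)
    (P : ℝ → X → ℝ → Measure X) : Prop :=
  (∀ u x t, T0 ≤ u → u < t → (t : EReal) < T1 → IsFiniteMeasure (P u x t)) ∧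
  (∀ (u : ℝ) (x : X) (B : Set X), MeasurableSet B → Measurable (fun t : ℝ => P u x t B))

/-- The right-hand side of Kolmogorov's forward equation:
`−∫_B q(y,t) P(u,x;t,dy) + ∫_X q⁺(y,t,B) P(u,x;t,dy)`. -/
noncomputable def fkeRHS {X : Type*} [MeasurableSpace X]
    (q : X → ℝ → ℝ) (qp : X → ℝ → Measure X)
    (P : ℝ → X → ℝ → Measure X) (u : ℝ) (x : X) (t : ℝ) (B : Set X) : ℝ :=
  -(∫ y in B, q y t ∂(P u x t)) + ∫ y, (qp y t B).toReal ∂(P u x t)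

/-- Property (Fi): boundary condition and absolute continuity for `(q,s)`-bounded sets. -/
def FwdI {X : Type*} [MeasurableSpace X] (q : X → ℝ → ℝ) (T0 : ℝ) (T1 : EReal)
    (P : ℝ → X → ℝ → Measure X) : Prop :=
  ∀ u : ℝ, T0 ≤ u → ∀ s : ℝ, u < s → (s : EReal) < T1 → ∀ x : X, ∀ B : Set X,
    QBddOn q T0 (s : EReal) B →
    Tendsto (fun t => (P u x t B).toReal) (nhdsWithin u (Set.Ioi u))
      (nhds (Set.indicator B (fun _ => (1:ℝ)) x)) ∧
    AbsContOn (fun t => (P u x t B).toReal) (Set.Ioo u s)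

/-- Property (Fii): Kolmogorov's forward equation a.e. on `(u,s)` for `(q,s)`-bounded sets. -/
def FwdII {X : Type*} [MeasurableSpace X] (q : X → ℝ → ℝ) (qp : X → ℝ → Measure X)
    (T0 : ℝ) (T1 : EReal) (P : ℝ → X → ℝ → Measure X) : Prop :=
  ∀ u : ℝ, T0 ≤ u → ∀ s : ℝ, u < s → (s : EReal) < T1 → ∀ x : X, ∀ B : Set X,
    QBddOn q T0 (s : EReal) B →
    ∀ᵐ t ∂(volume.restrict (Set.Ioo u s)),
      HasDerivAt (fun r => (P u x r B).toReal) (fkeRHS q qp P u x t B) t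

/-- (Fi) restricted to `q`-bounded sets. -/
def FwdIQ {X : Type*} [MeasurableSpace X] (q : X → ℝ → ℝ) (T0 : ℝ) (T1 : EReal)
    (P : ℝ → X → ℝ → Measure X) : Prop :=
  ∀ u : ℝ, T0 ≤ u → ∀ s : ℝ, u < s → (s : EReal) < T1 → ∀ x : X, ∀ B : Set X,
    QBddOn q T0 T1 B →
    Tendsto (fun t => (P u x t B).toReal) (nhdsWithin u (Set.Ioi u))
      (nhds (Set.indicator B (fun _ => (1:ℝ)) x)) ∧
    AbsContOn (fun t => (P u x t B).toReal) (Set.Ioo u s)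

/-- (Fii) restricted to `q`-bounded sets. -/
def FwdIIQ {X : Type*} [MeasurableSpace X] (q : X → ℝ → ℝ) (qp : X → ℝ → Measure X)
    (T0 : ℝ) (T1 : EReal) (P : ℝ → X → ℝ → Measure X) : Prop :=
  ∀ u : ℝ, T0 ≤ u → ∀ s : ℝ, u < s → (s : EReal) < T1 → ∀ x : X, ∀ B : Set X,
    QBddOn q T0 T1 B →
    ∀ᵐ t ∂(volume.restrict (Set.Ioo u s)),
      HasDerivAt (fun r => (P u x r B).toReal) (fkeRHS q qp P u x t B) t

/-- Property (a): boundary condition and absolute continuity, `q`-bounded sets. -/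
def FwdA {X : Type*} [MeasurableSpace X] (q : X → ℝ → ℝ) (T0 : ℝ) (T1 : EReal)
    (P : ℝ → X → ℝ → Measure X) : Prop :=
  ∀ u : ℝ, T0 ≤ u → (u : EReal) < T1 → ∀ x : X, ∀ B : Set X, QBddOn q T0 T1 B →
    Tendsto (fun t => (P u x t B).toReal) (nhdsWithin u (Set.Ioi u))
      (nhds (Set.indicator B (fun _ => (1:ℝ)) x)) ∧
    ∀ s : ℝ, u < s → (s : EReal) < T1 →
      AbsContOn (fun t => (P u x t B).toReal) (Set.Ioo u s)

/-- Property (b): forward equation a.e. on the whole interval `(u,T1)`, `q`-bounded sets. -/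
def FwdB {X : Type*} [MeasurableSpace X] (q : X → ℝ → ℝ) (qp : X → ℝ → Measure X)
    (T0 : ℝ) (T1 : EReal) (P : ℝ → X → ℝ → Measure X) : Prop :=
  ∀ u : ℝ, T0 ≤ u → (u : EReal) < T1 → ∀ x : X, ∀ B : Set X, QBddOn q T0 T1 B →
    ∀ᵐ t ∂(volume.restrict (IooE u T1)),
      HasDerivAt (fun r => (P u x r B).toReal) (fkeRHS q qp P u x t B) t

/-- The integral equation (IE). -/
def IntEq {X : Type*} [MeasurableSpace X] (q : X → ℝ → ℝ) (qp : X → ℝ → Measure X)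
    (P : ℝ → X → ℝ → Measure X) (u : ℝ) (x : X) (t : ℝ) (B : Set X) : Prop :=
  P u x t B = Set.indicator B (fun _ => ENNReal.ofReal (Real.exp (-(qInt q x u t)))) x
    + ∫⁻ w in Set.Ioo u t,
        ∫⁻ z, (∫⁻ y in B, ENNReal.ofReal (Real.exp (-(qInt q y w t))) ∂(qp z w)) ∂(P u x w)

/-- The integral form (FE) of the forward equation. -/
def FEq {X : Type*} [MeasurableSpace X] (q : X → ℝ → ℝ) (qp : X → ℝ → Measure X)
    (P : ℝ → X → ℝ → Measure X) (u : ℝ) (x : X) (t : ℝ) (B : Set X) : Prop :=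
  (P u x t B).toReal = Set.indicator B (fun _ => (1:ℝ)) x
    - ∫ w in Set.Ioo u t, ∫ y in B, q y w ∂(P u x w)
    + ∫ w in Set.Ioo u t, ∫ y, (qp y w B).toReal ∂(P u x w)

/-- Property (Bi): boundary condition and absolute continuity in `u` (backward). -/
def BkwdI {X : Type*} [MeasurableSpace X] (T0 : ℝ) (T1 : EReal)
    (P : ℝ → X → ℝ → Set X → ℝ) : Prop :=
  ∀ t : ℝ, T0 < t → (t : EReal) < T1 → ∀ x : X, ∀ B : Set X, MeasurableSet B →
    Tendsto (fun u => P u x t B) (nhdsWithin t (Set.Iio t))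
      (nhds (Set.indicator B (fun _ => (1:ℝ)) x)) ∧
    AbsContOn (fun u => P u x t B) (Set.Ico T0 t)

/-- Property (Bii): Kolmogorov's backward equation a.e. on `[T0,t)`. -/
def BkwdII {X : Type*} [MeasurableSpace X] (q : X → ℝ → ℝ) (qp : X → ℝ → Measure X)
    (T0 : ℝ) (T1 : EReal) (P : ℝ → X → ℝ → Set X → ℝ) : Prop :=
  ∀ t : ℝ, T0 < t → (t : EReal) < T1 → ∀ x : X, ∀ B : Set X, MeasurableSet B →
    ∀ᵐ u ∂(volume.restrict (Set.Ico T0 t)),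
      HasDerivAt (fun v => P v x t B)
        (q x u * P u x t B - ∫ y, P u y t B ∂(qp x u)) u

/-- (FE) for all `q`-bounded sets and all `t ∈ (u,T1)`. -/
def FEqAll {X : Type*} [MeasurableSpace X] (q : X → ℝ → ℝ) (qp : X → ℝ → Measure X)
    (T0 : ℝ) (T1 : EReal) (P : ℝ → X → ℝ → Measure X) : Prop :=
  ∀ u : ℝ, T0 ≤ u → ∀ x : X, ∀ B : Set X, QBddOn q T0 T1 B →
    ∀ t : ℝ, u < t → (t : EReal) < T1 → FEq q qp P u x t B

/-- (FE) for all `(q,s)`-bounded sets and all `t ∈ (u,s)`. -/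
def FEqAllS {X : Type*} [MeasurableSpace X] (q : X → ℝ → ℝ) (qp : X → ℝ → Measure X)
    (T0 : ℝ) (T1 : EReal) (P : ℝ → X → ℝ → Measure X) : Prop :=
  ∀ u : ℝ, T0 ≤ u → ∀ s : ℝ, u < s → (s : EReal) < T1 → ∀ x : X, ∀ B : Set X,
    QBddOn q T0 (s : EReal) B → ∀ t : ℝ, u < t → t < s → FEq q qp P u x t B

/-- (IE) for all measurable sets and all `u ∈ [T0,T1)`, `t ∈ (u,T1)`. -/
def IntEqAll {X : Type*} [MeasurableSpace X] (q : X → ℝ → ℝ) (qp : X → ℝ → Measure X)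
    (T0 : ℝ) (T1 : EReal) (P : ℝ → X → ℝ → Measure X) : Prop :=
  ∀ u : ℝ, T0 ≤ u → ∀ t : ℝ, u < t → (t : EReal) < T1 → ∀ x : X, ∀ B : Set X,
    MeasurableSet B → IntEq q qp P u x t B

open ProbabilityTheory NNReal ENNReal

theorem ProbabilityTheory.Kernel.isSFiniteKernel_of_forall_ne_top {α β : Type*} [MeasurableSpace α]
    [MeasurableSpace β] (κ : Kernel α β) (h : ∀ a, κ a univ ≠ ∞) : IsSFiniteKernel κ := by
  have hm : Measurable fun a => κ a univ := κ.measurable_coe MeasurableSet.univ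
  let η : Kernel α β :=
    { toFun := fun a => (κ a univ)⁻¹ • κ a
      measurable' := by
        refine Measure.measurable_of_measurable_coe _ fun s hs => ?_
        simpa [Pi.mul_def] using hm.inv.mul (κ.measurable_coe hs) }
  have hη : IsFiniteKernel η := by
    refine ⟨1, ENNReal.one_lt_top, fun a => ?_⟩
    change ((κ a univ)⁻¹ • κ a) univ ≤ 1
    simp [ENNReal.inv_mul_le_one]
  have hκ : κ = η.withDensity fun a _ => κ a univ := by
    ext a s hs
    rw [Kernel.withDensity_apply' _ (by exact hm.comp measurable_fst)]
    change κ a s = ∫⁻ _ in s, κ a univ ∂((κ a univ)⁻¹ • κ a)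
    rw [MeasureTheory.setLIntegral_const, Measure.smul_apply, smul_eq_mul, ← mul_assoc]
    by_cases h0 : κ a univ = 0
    · simp [Measure.measure_univ_eq_zero.1 h0]
    · rw [ENNReal.mul_inv_cancel h0 (h a), one_mul]
  rw [hκ]
  exact Kernel.IsSFiniteKernel.withDensity η fun a _ => h a

theorem lintegral_Ioo_lintegral_Ioo_swap {F : ℝ → ℝ → ℝ≥0∞} (hF : Measurable (Function.uncurry F))
    (u t : ℝ) :
    ∫⁻ w in Ioo u t, ∫⁻ v in Ioo w t, F w v = ∫⁻ v in Ioo u t, ∫⁻ w in Ioo u v, F w v := by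
  let D : Set (ℝ × ℝ) := {p | u < p.1 ∧ p.1 < p.2 ∧ p.2 < t}
  have hD : MeasurableSet D :=
    (measurableSet_lt measurable_const measurable_fst).inter
      ((measurableSet_lt measurable_fst measurable_snd).inter
        (measurableSet_lt measurable_snd measurable_const))
  have hl : ∫⁻ w in Ioo u t, ∫⁻ v in Ioo w t, F w v
      = ∫⁻ w, ∫⁻ v, D.indicator (Function.uncurry F) (w, v) := by
    rw [← lintegral_indicator measurableSet_Ioo]
    refine lintegral_congr fun w => ?_
    by_cases hw : w ∈ Ioo u t
    · rw [indicator_of_mem hw, ← lintegral_indicator measurableSet_Ioo]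
      refine lintegral_congr fun v => ?_
      simp only [indicator, D, mem_Ioo, mem_ofPred_eq, Function.uncurry, hw.1, true_and]
    · rw [indicator_of_notMem hw, eq_comm, lintegral_eq_zero_iff (by fun_prop)]
      refine Eventually.of_forall fun v => indicator_of_notMem ?_ _
      exact fun h => hw ⟨h.1, h.2.1.trans h.2.2⟩
  have hr : ∫⁻ v in Ioo u t, ∫⁻ w in Ioo u v, F w v
      = ∫⁻ v, ∫⁻ w, D.indicator (Function.uncurry F) (w, v) := by
    rw [← lintegral_indicator measurableSet_Ioo]
    refine lintegral_congr fun v => ?_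
    by_cases hv : v ∈ Ioo u t
    · rw [indicator_of_mem hv, ← lintegral_indicator measurableSet_Ioo]
      refine lintegral_congr fun w => ?_
      simp only [indicator, D, mem_Ioo, mem_ofPred_eq, Function.uncurry, hv.2, and_true]
    · rw [indicator_of_notMem hv, eq_comm, lintegral_eq_zero_iff (by fun_prop)]
      refine Eventually.of_forall fun w => indicator_of_notMem ?_ _
      exact fun h => hv ⟨h.1.trans h.2.1, h.2.2⟩
  rw [hl, hr]
  exact lintegral_lintegral_swap (hF.indicator hD).aemeasurable

section FellerKernel

variable {X : Type*} [MeasurableSpace X]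

/-- The kernel of the time of the first jump: it sends `(u, x, t)` to the measure with density
`w ↦ g (u, x, w)` on `(u, t)`. -/
noncomputable def jumpTimeKernel (g : ℝ × X × ℝ → ℝ≥0) : Kernel (ℝ × X × ℝ) ℝ :=
  (Kernel.const (ℝ × X × ℝ) (volume : Measure ℝ)).withDensity fun p w =>
    (({r : (ℝ × X × ℝ) × ℝ | r.1.1 < r.2 ∧ r.2 < r.1.2.2}.indicator
      (fun r => g (r.1.1, r.1.2.1, r.2)) (p, w) : ℝ≥0) : ℝ≥0∞)

instance (g : ℝ × X × ℝ → ℝ≥0) : IsSFiniteKernel (jumpTimeKernel g) := by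
  unfold jumpTimeKernel
  exact Kernel.IsSFiniteKernel.withDensity _ fun _ _ => ENNReal.coe_ne_top

theorem lintegral_jumpTimeKernel {g : ℝ × X × ℝ → ℝ≥0} (hg : Measurable g) (u : ℝ) (x : X) (t : ℝ)
    {f : ℝ → ℝ≥0∞} (hf : Measurable f) :
    ∫⁻ w, f w ∂jumpTimeKernel g (u, x, t) = ∫⁻ w in Ioo u t, g (u, x, w) * f w := by
  have hD : MeasurableSet {r : (ℝ × X × ℝ) × ℝ | r.1.1 < r.2 ∧ r.2 < r.1.2.2} :=
    (measurableSet_lt (measurable_fst.comp measurable_fst) measurable_snd).inter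
      (measurableSet_lt measurable_snd (measurable_snd.comp (measurable_snd.comp measurable_fst)))
  have hm : Measurable fun r : (ℝ × X × ℝ) × ℝ => g (r.1.1, r.1.2.1, r.2) := by fun_prop
  rw [jumpTimeKernel, Kernel.lintegral_withDensity _
      (by exact (hm.indicator hD).coe_nnreal_ennreal) _ hf,
    Kernel.const_apply, ← lintegral_indicator measurableSet_Ioo]
  refine lintegral_congr fun w => ?_
  by_cases hw : w ∈ Ioo u t
  · rw [indicator_of_mem hw, indicator_of_mem (by exact hw)]
  · rw [indicator_of_notMem hw, indicator_of_notMem (by exact hw)]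
    simp

/-- The Feller iterates as kernels in `(u, x, t)`, for survival weight `g (u, x, t)` and jump
kernel `κ (x, w)`. -/
noncomputable def fellerKernel (g : ℝ × X × ℝ → ℝ≥0) (κ : Kernel (X × ℝ) X) :
    ℕ → Kernel (ℝ × X × ℝ) X
  | 0 => (Kernel.deterministic (fun p : ℝ × X × ℝ => p.2.1)
      (measurable_fst.comp measurable_snd)).withDensity fun p _ => (g p : ℝ≥0∞)
  | n + 1 => ((jumpTimeKernel g ⊗ₖ
        κ.comap (fun r : (ℝ × X × ℝ) × ℝ => (r.1.2.1, r.2)) (by fun_prop)) ⊗ₖ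
      (fellerKernel g κ n).comap
        (fun r : (ℝ × X × ℝ) × (ℝ × X) => (r.2.1, r.2.2, r.1.2.2)) (by fun_prop)).snd

instance (g : ℝ × X × ℝ → ℝ≥0) (κ : Kernel (X × ℝ) X) [IsSFiniteKernel κ] (n : ℕ) :
    IsSFiniteKernel (fellerKernel g κ n) := by
  cases n with
  | zero => exact Kernel.IsSFiniteKernel.withDensity _ fun _ _ => ENNReal.coe_ne_top
  | succ n => unfold fellerKernel; infer_instance

variable {g : ℝ × X × ℝ → ℝ≥0} (κ : Kernel (X × ℝ) X)

theorem fellerKernel_zero_apply (hg : Measurable g) (u : ℝ) (x : X) (t : ℝ) :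
    fellerKernel g κ 0 (u, x, t) = (g (u, x, t) : ℝ≥0∞) • Measure.dirac x := by
  rw [fellerKernel, Kernel.withDensity_apply _
      (by exact (hg.comp measurable_fst).coe_nnreal_ennreal),
    withDensity_const, Kernel.deterministic_apply]

theorem lintegral_fellerKernel_zero (hg : Measurable g) (u : ℝ) (x : X) (t : ℝ) {f : X → ℝ≥0∞}
    (hf : Measurable f) :
    ∫⁻ z, f z ∂fellerKernel g κ 0 (u, x, t) = g (u, x, t) * f x := by
  rw [fellerKernel_zero_apply κ hg, lintegral_smul_measure, lintegral_dirac' _ hf, smul_eq_mul]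

variable [IsSFiniteKernel κ]

theorem lintegral_fellerKernel_succ (hg : Measurable g) (n : ℕ) (u : ℝ) (x : X) (t : ℝ)
    {f : X → ℝ≥0∞} (hf : Measurable f) :
    ∫⁻ z, f z ∂fellerKernel g κ (n + 1) (u, x, t) =
      ∫⁻ w in Ioo u t, g (u, x, w) * ∫⁻ y, ∫⁻ z, f z ∂fellerKernel g κ n (w, y, t) ∂κ (x, w) := by
  have h1 : Measurable fun p : ℝ × X × ℝ => ∫⁻ z, f z ∂fellerKernel g κ n p := hf.lintegral_kernel
  have h2 : Measurable fun r : ℝ × X => ∫⁻ z, f z ∂fellerKernel g κ n (r.1, r.2, t) :=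
    h1.comp (by fun_prop)
  have h3 : Measurable fun w : ℝ => ∫⁻ y, ∫⁻ z, f z ∂fellerKernel g κ n (w, y, t) ∂κ (x, w) :=
    Measurable.lintegral_kernel_prod_right
      (κ := κ.comap (fun w : ℝ => (x, w)) (by fun_prop)) (by exact h2)
  rw [fellerKernel, Kernel.lintegral_snd _ _ hf, Kernel.lintegral_compProd _ _ _ (by fun_prop)]
  simp only [Kernel.comap_apply]
  rw [Kernel.lintegral_compProd _ _ _ h2]
  simp only [Kernel.comap_apply]
  rw [lintegral_jumpTimeKernel hg _ _ _ h3]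

theorem measurable_lintegral_jump (hg : Measurable g) (t : ℝ) {f : X → ℝ≥0∞} (hf : Measurable f) :
    Measurable fun p : ℝ × X => ∫⁻ y, g (p.1, y, t) * f y ∂κ (p.2, p.1) :=
  Measurable.lintegral_kernel_prod_right
    (κ := κ.comap (fun p : ℝ × X => (p.2, p.1)) (by fun_prop))
    (by unfold Function.uncurry; fun_prop)

/-- The Feller iterates, built by conditioning on the first jump, also satisfy the recursion
obtained by conditioning on the last jump. -/
theorem lintegral_fellerKernel_succ_last (hg : Measurable g) (n : ℕ) (u : ℝ) (x : X) (t : ℝ)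
    {f : X → ℝ≥0∞} (hf : Measurable f) :
    ∫⁻ z, f z ∂fellerKernel g κ (n + 1) (u, x, t) =
      ∫⁻ w in Ioo u t, ∫⁻ z, ∫⁻ y, g (w, y, t) * f y ∂κ (z, w) ∂fellerKernel g κ n (u, x, w) := by
  have hh := measurable_lintegral_jump κ hg t hf
  have hhw (w : ℝ) : Measurable fun z => ∫⁻ y, g (w, y, t) * f y ∂κ (z, w) :=
    hh.comp (measurable_const.prodMk measurable_id)
  induction n generalizing u x with
  | zero =>
    rw [lintegral_fellerKernel_succ κ hg _ _ _ _ hf]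
    simp only [lintegral_fellerKernel_zero κ hg _ _ _ hf,
      lintegral_fellerKernel_zero κ hg _ _ _ (hhw _)]
  | succ n ih =>
    rw [lintegral_fellerKernel_succ κ hg _ _ _ _ hf]
    simp only [ih, lintegral_fellerKernel_succ κ hg n _ _ _ (hhw _)]
    have hP : Measurable fun p : ℝ × X × ℝ =>
        ∫⁻ z, ∫⁻ y, g (p.2.2, y, t) * f y ∂κ (z, p.2.2) ∂fellerKernel g κ n p :=
      Measurable.lintegral_kernel_prod_right (by
        exact hh.comp (by fun_prop : Measurable fun r : (ℝ × X × ℝ) × X => (r.1.2.2, r.2)))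
    have hF : Measurable fun r : ℝ × ℝ => ∫⁻ a, ∫⁻ z, ∫⁻ y, g (r.2, y, t) * f y ∂κ (z, r.2)
        ∂fellerKernel g κ n (r.1, a, r.2) ∂κ (x, r.1) :=
      Measurable.lintegral_kernel_prod_right
        (κ := κ.comap (fun r : ℝ × ℝ => (x, r.1)) (by fun_prop)) (by
          exact hP.comp (by fun_prop : Measurable fun r : (ℝ × ℝ) × X => (r.1.1, r.2, r.1.2)))
    rw [← lintegral_Ioo_lintegral_Ioo_swap (F := fun w v => g (u, x, w) *
      ∫⁻ a, ∫⁻ z, ∫⁻ y, g (v, y, t) * f y ∂κ (z, v) ∂fellerKernel g κ n (w, a, v) ∂κ (x, w))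
      (by
        have : Measurable fun r : ℝ × ℝ => (g (u, x, r.1) : ℝ≥0∞) := by fun_prop
        exact this.mul hF)]
    refine lintegral_congr fun w => ?_
    rw [lintegral_const_mul _ (by exact hF.comp (measurable_const.prodMk measurable_id)),
      lintegral_lintegral_swap]
    exact (hP.comp (by fun_prop : Measurable fun r : X × ℝ => (w, r.1, r.2))).aemeasurable

theorem measurable_lintegral_lintegral_jump (hg : Measurable g) (n : ℕ) (u : ℝ) (x : X) (t : ℝ)
    {f : X → ℝ≥0∞} (hf : Measurable f) :
    Measurable fun w =>
      ∫⁻ z, ∫⁻ y, g (w, y, t) * f y ∂κ (z, w) ∂fellerKernel g κ n (u, x, w) :=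
  Measurable.lintegral_kernel_prod_right
    (κ := (fellerKernel g κ n).comap (fun w : ℝ => (u, x, w)) (by fun_prop))
    (by exact measurable_lintegral_jump κ hg t hf)

end FellerKernel

section Pbar

variable {X : Type*} [MeasurableSpace X] {q : X → ℝ → ℝ} {qp : X → ℝ → Measure X}

/-- The survival probability `exp (-∫_u^t q(x,θ) dθ)` as a function of `(u, x, t)`. -/
noncomputable def survival (q : X → ℝ → ℝ) (p : ℝ × X × ℝ) : ℝ≥0 :=
  (Real.exp (-(qInt q p.2.1 p.1 p.2.2))).toNNReal

theorem measurable_survival (hq : Measurable (Function.uncurry q)) : Measurable (survival q) := by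
  have hD : MeasurableSet {r : (ℝ × X × ℝ) × ℝ | r.1.1 < r.2 ∧ r.2 < r.1.2.2} :=
    (measurableSet_lt (measurable_fst.comp measurable_fst) measurable_snd).inter
      (measurableSet_lt measurable_snd (measurable_snd.comp (measurable_snd.comp measurable_fst)))
  have hm : Measurable fun r : (ℝ × X × ℝ) × ℝ => q r.1.2.1 r.2 :=
    hq.comp (by fun_prop : Measurable fun r : (ℝ × X × ℝ) × ℝ => (r.1.2.1, r.2))
  have hI : Measurable fun p : ℝ × X × ℝ => qInt q p.2.1 p.1 p.2.2 := by
    have := ((hm.indicator hD).stronglyMeasurable.integral_prod_right' (ν := volume)).measurable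
    convert this using 2 with p
    rw [qInt, ← integral_indicator measurableSet_Ioo]
    rfl
  unfold survival
  fun_prop

variable {S : Set ℝ} {κ : Kernel (X × ℝ) X}

theorem intEq_iff (hκ : ∀ x, ∀ w ∈ S, κ (x, w) = qp x w) {P : ℝ → X → ℝ → Measure X}
    {u : ℝ} {x : X} {t : ℝ} (hS : Ioo u t ⊆ S) {B : Set X} (hB : MeasurableSet B) :
    IntEq q qp P u x t B ↔ P u x t B = survival q (u, x, t) * B.indicator 1 x +
      ∫⁻ w in Ioo u t, ∫⁻ z, ∫⁻ y, survival q (w, y, t) * B.indicator 1 y ∂κ (z, w) ∂P u x w := by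
  have h0 : B.indicator (fun _ => ENNReal.ofReal (Real.exp (-(qInt q x u t)))) x =
      survival q (u, x, t) * B.indicator 1 x := by
    by_cases hx : x ∈ B <;> simp [hx, survival, ENNReal.ofReal]
  have h1 : ∫⁻ w in Ioo u t, ∫⁻ z,
        (∫⁻ y in B, ENNReal.ofReal (Real.exp (-(qInt q y w t))) ∂qp z w) ∂P u x w =
      ∫⁻ w in Ioo u t, ∫⁻ z, ∫⁻ y, survival q (w, y, t) * B.indicator 1 y ∂κ (z, w) ∂P u x w := by
    refine setLIntegral_congr_fun measurableSet_Ioo fun w hw => lintegral_congr fun z => ?_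
    rw [hκ z w (hS hw), ← lintegral_indicator hB]
    refine lintegral_congr fun y => ?_
    by_cases hy : y ∈ B <;> simp [hy, survival, ENNReal.ofReal]
  rw [IntEq, h0, h1]

variable [IsSFiniteKernel κ]

theorem PbarM_eq_fellerKernel (hq : Measurable (Function.uncurry q))
    (hκ : ∀ x, ∀ w ∈ S, κ (x, w) = qp x w) (n : ℕ) (u : ℝ) (x : X) (t : ℝ) (hS : Ioo u t ⊆ S) :
    PbarM q qp n u x t = fellerKernel (survival q) κ n (u, x, t) := by
  have hg := measurable_survival hq
  induction n generalizing u x with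
  | zero => rw [fellerKernel_zero_apply κ hg]; rfl
  | succ n ih =>
    have hcongr : ∀ᵐ w ∂volume.restrict (Ioo u t),
        ((ENNReal.ofReal (Real.exp (-(qInt q x u w))) • qp x w).bind fun y => PbarM q qp n w y t) =
        ((survival q (u, x, w) : ℝ≥0∞) • κ (x, w)).bind
          fun y => fellerKernel (survival q) κ n (w, y, t) := by
      refine ae_restrict_of_forall_mem measurableSet_Ioo fun w hw => ?_
      rw [hκ x w (hS hw)]
      congr 1
      funext y
      exact ih w y ((Ioo_subset_Ioo_left hw.1.le).trans hS)
    have hk (w : ℝ) : Measurable fun y => fellerKernel (survival q) κ n (w, y, t) :=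
      (Kernel.measurable _).comp (by fun_prop)
    have hbind (w : ℝ) {s : Set X} (hs : MeasurableSet s) :
        ((survival q (u, x, w) : ℝ≥0∞) • κ (x, w)).bind
          (fun y => fellerKernel (survival q) κ n (w, y, t)) s =
        survival q (u, x, w) * ∫⁻ y, fellerKernel (survival q) κ n (w, y, t) s ∂κ (x, w) := by
      rw [Measure.bind_apply hs (hk w).aemeasurable, lintegral_smul_measure, smul_eq_mul]
    rw [PbarM, Measure.bind_congr_right hcongr]
    ext s hs
    rw [Measure.bind_apply hs]
    · simp only [hbind _ hs]
      rw [← lintegral_indicator_one hs, lintegral_fellerKernel_succ κ hg _ _ _ _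
        (measurable_one.indicator hs)]
      simp only [lintegral_indicator_one hs]
    · refine (Measure.measurable_of_measurable_coe _ fun s hs => ?_).aemeasurable
      simp only [hbind _ hs]
      have h1 : Measurable fun w => (survival q (u, x, w) : ℝ≥0∞) := by fun_prop
      refine h1.mul (Measurable.lintegral_kernel_prod_right
        (κ := κ.comap (fun w : ℝ => (x, w)) (by fun_prop)) ?_)
      exact (Kernel.measurable_coe _ hs).comp
        (by fun_prop : Measurable fun r : ℝ × X => (r.1, r.2, t))

theorem PbarMeas_eq_sum_fellerKernel (hq : Measurable (Function.uncurry q))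
    (hκ : ∀ x, ∀ w ∈ S, κ (x, w) = qp x w) (u : ℝ) (x : X) (t : ℝ) (hS : Ioo u t ⊆ S) :
    PbarMeas q qp u x t = Measure.sum fun n => fellerKernel (survival q) κ n (u, x, t) := by
  simp only [PbarMeas, PbarM_eq_fellerKernel hq hκ _ u x t hS]

theorem intEq_PbarMeas (hq : Measurable (Function.uncurry q))
    (hκ : ∀ x, ∀ w ∈ S, κ (x, w) = qp x w) (u : ℝ) (x : X) (t : ℝ) (hS : Ioo u t ⊆ S)
    {B : Set X} (hB : MeasurableSet B) : IntEq q qp (PbarMeas q qp) u x t B := by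
  have hg := measurable_survival hq
  have hf : Measurable (B.indicator (1 : X → ℝ≥0∞)) := measurable_one.indicator hB
  rw [intEq_iff hκ hS hB, PbarMeas_eq_sum_fellerKernel hq hκ u x t hS, Measure.sum_apply _ hB,
    tsum_eq_zero_add' ENNReal.summable]
  simp only [← lintegral_indicator_one hB, lintegral_fellerKernel_zero κ hg _ _ _ hf,
    lintegral_fellerKernel_succ_last κ hg _ _ _ _ hf]
  rw [← lintegral_tsum fun n =>
    (measurable_lintegral_lintegral_jump κ hg n u x t hf).aemeasurable]
  congr 1
  refine setLIntegral_congr_fun measurableSet_Ioo fun w hw => ?_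
  rw [PbarMeas_eq_sum_fellerKernel hq hκ u x w ((Ioo_subset_Ioo_right hw.2.le).trans hS),
    lintegral_sum_measure]

theorem PbarMeas_le_of_intEq (hq : Measurable (Function.uncurry q))
    (hκ : ∀ x, ∀ w ∈ S, κ (x, w) = qp x w) {P : ℝ → X → ℝ → Measure X} {u : ℝ} {x : X} {t : ℝ}
    (hut : u < t) (hS : Ioo u t ⊆ S)
    (hP : ∀ w, u < w → w ≤ t → ∀ B, MeasurableSet B → IntEq q qp P u x w B) :
    PbarMeas q qp u x t ≤ P u x t := by
  have hg := measurable_survival hq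
  have key (n : ℕ) : ∀ w, u < w → w ≤ t →
      ∑ i ∈ Finset.range n, fellerKernel (survival q) κ i (u, x, w) ≤ P u x w := by
    induction n with
    | zero => simp [Measure.zero_le]
    | succ n ih =>
      intro w huw hwt
      refine Measure.le_iff.2 fun B hB => ?_
      have hf : Measurable (B.indicator (1 : X → ℝ≥0∞)) := measurable_one.indicator hB
      rw [(intEq_iff hκ ((Ioo_subset_Ioo_right hwt).trans hS) hB).1 (hP w huw hwt B hB),
        Measure.finsetSum_apply, Finset.sum_range_succ', add_comm]
      simp only [← lintegral_indicator_one hB, lintegral_fellerKernel_zero κ hg _ _ _ hf,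
        lintegral_fellerKernel_succ_last κ hg _ _ _ _ hf]
      rw [← lintegral_finsetSum _ fun i _ => measurable_lintegral_lintegral_jump κ hg i u x w hf]
      gcongr 1
      refine setLIntegral_mono' measurableSet_Ioo fun v hv => ?_
      rw [← lintegral_finsetSum_measure]
      exact lintegral_mono' (ih v hv.1 (hv.2.le.trans hwt)) le_rfl
  refine Measure.le_iff.2 fun B hB => ?_
  rw [PbarMeas_eq_sum_fellerKernel hq hκ u x t hS, Measure.sum_apply _ hB]
  refine ENNReal.tsum_le_of_sum_range_le fun n => ?_
  rw [← Measure.finsetSum_apply]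
  exact key n t hut le_rfl B

end Pbar

theorem pbar_minimal_solution_of_integral_equation
    {X : Type*} [MeasurableSpace X] [StandardBorelSpace X]
    (T0 : ℝ) (T1 : EReal) (hT0 : 0 ≤ T0) (hT01 : (T0 : EReal) < T1)
    (q : X → ℝ → ℝ) (qp : X → ℝ → Measure X)
    (hq_nonneg : ∀ x t, T0 ≤ t → (t : EReal) < T1 → 0 ≤ q x t)
    (hq_meas : Measurable (Function.uncurry q))
    (hqp_self : ∀ x t, T0 ≤ t → (t : EReal) < T1 → qp x t {x} = 0)
    (hqp_total : ∀ x t, T0 ≤ t → (t : EReal) < T1 → qp x t Set.univ = ENNReal.ofReal (q x t))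
    (hqp_meas : ∀ B : Set X, MeasurableSet B → Measurable (fun p : X × ℝ => qp p.1 p.2 B))
    (hALB : ∀ x : X, ∀ s : ℝ, T0 < s → (s : EReal) < T1 →
      ∃ M : ℝ, ∀ t : ℝ, T0 ≤ t → t < s → q x t ≤ M)
    :
    IntEqAll q qp T0 T1 (PbarMeas q qp) ∧
    (∀ P : ℝ → X → ℝ → Measure X, MemPhat T0 T1 P → IntEqAll q qp T0 T1 P →
      ∀ u : ℝ, T0 ≤ u → ∀ t : ℝ, u < t → (t : EReal) < T1 → ∀ x : X, ∀ B : Set X,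
        MeasurableSet B → PbarMeas q qp u x t B ≤ P u x t B) ∧
    ((∀ (u : ℝ) (x : X) (t : ℝ), T0 ≤ u → u < t → (t : EReal) < T1 →
        PbarMeas q qp u x t Set.univ = 1) →
      ∀ P : ℝ → X → ℝ → Measure X, MemPhat T0 T1 P →
        (∀ (u : ℝ) (x : X) (t : ℝ) (B : Set X), T0 ≤ u → u < t → (t : EReal) < T1 →
          MeasurableSet B → P u x t B ≤ 1) →
        IntEqAll q qp T0 T1 P →
        ∀ (u : ℝ) (x : X) (t : ℝ) (B : Set X), T0 ≤ u → u < t → (t : EReal) < T1 →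
          MeasurableSet B → P u x t B = PbarMeas q qp u x t B) := by
  let S : Set ℝ := {s | T0 ≤ s ∧ (s : EReal) < T1}
  have hS : MeasurableSet S :=
    measurableSet_Ici.inter (measurableSet_lt measurable_coe_real_ereal measurable_const)
  have hsub : ∀ u t : ℝ, T0 ≤ u → (t : EReal) < T1 → Ioo u t ⊆ S := fun u t hu ht w hw =>
    ⟨hu.trans hw.1.le, (EReal.coe_lt_coe_iff.2 hw.2).trans ht⟩
  let κ : Kernel (X × ℝ) X :=
    { toFun := (Prod.snd ⁻¹' S).indicator fun p => qp p.1 p.2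
      measurable' :=
        (Measure.measurable_of_measurable_coe _ hqp_meas).indicator (measurable_snd hS) }
  have hκ : ∀ x, ∀ w ∈ S, κ (x, w) = qp x w := fun x w hw =>
    indicator_of_mem (s := Prod.snd ⁻¹' S) (a := (x, w)) hw
      fun p => qp p.1 p.2
  have : IsSFiniteKernel κ := by
    refine Kernel.isSFiniteKernel_of_forall_ne_top κ fun ⟨x, w⟩ => ?_
    by_cases hw : w ∈ S
    · rw [hκ x w hw, hqp_total x w hw.1 hw.2]
      exact ENNReal.ofReal_ne_top
    · have h0 : κ (x, w) = 0 := indicator_of_notMem (s := Prod.snd ⁻¹' S) (a := (x, w)) hw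
        fun p => qp p.1 p.2
      simp [h0]
  have hmin : ∀ P : ℝ → X → ℝ → Measure X, IntEqAll q qp T0 T1 P →
      ∀ u : ℝ, T0 ≤ u → ∀ t : ℝ, u < t → (t : EReal) < T1 → ∀ x : X,
        PbarMeas q qp u x t ≤ P u x t := fun P hP u hu t hut ht x =>
    PbarMeas_le_of_intEq hq_meas hκ hut (hsub u t hu ht) fun w huw hwt B hB =>
      hP u hu w huw ((EReal.coe_le_coe_iff.2 hwt).trans_lt ht) x B hB
  refine ⟨fun u hu t _ ht x B hB => intEq_PbarMeas hq_meas hκ u x t (hsub u t hu ht) hB,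
    fun P _ hP u hu t hut ht x B _ => hmin P hP u hu t hut ht x B, ?_⟩
  intro hreg P hPhat hP1 hP u x t B hu hut ht hB
  have hle := hmin P hP u hu t hut ht x
  have := hPhat.1 u x t hu hut ht
  have hsum : P u x t B + P u x t Bᶜ ≤ PbarMeas q qp u x t B + PbarMeas q qp u x t Bᶜ := by
    rw [measure_add_measure_compl hB, measure_add_measure_compl hB, hreg u x t hu hut ht]
    exact hP1 u x t univ hu hut ht MeasurableSet.univ
  refine le_antisymm ?_ (hle B)
  exact (ENNReal.add_le_add_iff_right (measure_ne_top (P u x t) Bᶜ)).1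
    (hsum.trans (by gcongr))
end

section
/- Under Assumption LB, a function P ∈ 𝒫̂ satisfies (Fi) and (Fii) (for all (q,s)-bounded sets) if and only if it satisfies: (a) for all u ∈ [T0,T1), x ∈ X, and every q-bounded set B, lim_{t→u+} P(u,x;t,B) = 1_B(x) and t ↦ P(u,x;t,B) is absolutely continuous on (u,s) for each s ∈ (u,T1); and (b) for all such u,x,B, the forward equation ∂/∂t P(u,x;t,B) = −∫_B q(y,t) P(u,x;t,dy) + ∫_X q⁺(y,t,B) P(u,x;t,dy) holds for almost every t ∈ (u,T1). -/
open MeasureTheory Set Filter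

/-- Countably many sets are Borel-separable if they have Borel supersets with empty
intersection. -/
def SeqMeasurablySeparable {α : Type*} [MeasurableSpace α] (A : ℕ → Set α) : Prop :=
  ∃ B : ℕ → Set α, (∀ n, MeasurableSet (B n)) ∧ (∀ n, A n ⊆ B n) ∧ ⋂ n, B n = ∅

theorem SeqMeasurablySeparable.of_iUnion {α : Type*} [MeasurableSpace α] {A : ℕ → Set α}
    (j : ℕ) {A' : ℕ → ℕ → Set α} (hj : A j ⊆ ⋃ m, A' m j)
    (hA : ∀ m n, n ≠ j → A n ⊆ A' m n) (h : ∀ m, SeqMeasurablySeparable (A' m)) :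
    SeqMeasurablySeparable A := by
  choose B hBm hAB hB using h
  refine ⟨fun n => if n = j then ⋃ m, B m n else ⋂ m, B m n, fun n => ?_, fun n => ?_, ?_⟩
  · dsimp only
    split_ifs
    · exact MeasurableSet.iUnion fun m => hBm m n
    · exact MeasurableSet.iInter fun m => hBm m n
  · dsimp only
    split_ifs with hn
    · subst hn
      exact hj.trans (iUnion_mono fun m => hAB m n)
    · exact subset_iInter fun m => (hA m n hn).trans (hAB m n)
  · rw [eq_empty_iff_forall_notMem]
    intro x hx
    rw [mem_iInter] at hx
    have hxj := hx j
    simp only [if_true, mem_iUnion] at hxj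
    obtain ⟨m, hm⟩ := hxj
    have hxm : x ∈ ⋂ n, B m n := by
      refine mem_iInter.2 fun n => ?_
      by_cases hn : n = j
      · rwa [hn]
      · have := hx n
        simp only [hn, if_false] at this
        exact mem_iInter.1 this m
    rw [hB m] at hxm
    exact hxm

/-- **Novikov's separation theorem** for continuous images of the Baire space. -/
theorem seqMeasurablySeparable_range {α : Type*} [TopologicalSpace α] [T2Space α]
    [MeasurableSpace α] [OpensMeasurableSpace α] {f : ℕ → (ℕ → ℕ) → α}
    (hf : ∀ n, Continuous (f n)) (h : ⋂ n, range (f n) = ∅) :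
    SeqMeasurablySeparable fun n => range (f n) := by
  by_contra hsep
  -- A point `z` codes the sequence of points `i ↦ z (Nat.pair n i)`, and `C z k` collects the
  -- cylinders prescribed by the first `k` coordinates of `z`.
  let C : (ℕ → ℕ) → ℕ → ℕ → Set α := fun z k n =>
    f n '' {y | ∀ i, Nat.pair n i < k → y i = z (Nat.pair n i)}
  have hCcongr : ∀ z z' k, (∀ i < k, z i = z' i) → C z k = C z' k := by
    intro z z' k hz
    funext n
    have : {y : ℕ → ℕ | ∀ i, Nat.pair n i < k → y i = z (Nat.pair n i)} =
        {y | ∀ i, Nat.pair n i < k → y i = z' (Nat.pair n i)} := by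
      ext y
      exact forall₂_congr fun i hi => by rw [hz _ hi]
    simp only [C, this]
  have hstep : ∀ z k, ¬ SeqMeasurablySeparable (C z k) →
      ∃ m, ¬ SeqMeasurablySeparable (C (Function.update z k m) (k + 1)) := by
    intro z k
    contrapose!
    intro hm
    refine SeqMeasurablySeparable.of_iUnion (Nat.unpair k).1 ?_ ?_ hm
    · rintro _ ⟨y, hy, rfl⟩
      refine mem_iUnion.2 ⟨y (Nat.unpair k).2, y, fun i hi => ?_, rfl⟩
      rcases (Nat.lt_succ_iff.1 hi).lt_or_eq with hi | hi
      · rw [Function.update_of_ne hi.ne]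
        exact hy i hi
      · have : i = (Nat.unpair k).2 := by rw [← hi, Nat.unpair_pair]
        rw [hi, Function.update_self, this]
    · rintro m n hn _ ⟨y, hy, rfl⟩
      refine ⟨y, fun i hi => ?_, rfl⟩
      rcases (Nat.lt_succ_iff.1 hi).lt_or_eq with hi | hi
      · rw [Function.update_of_ne hi.ne]
        exact hy i hi
      · exact absurd (by rw [← hi, Nat.unpair_pair]) hn
  choose! m hm using hstep
  let Z : ℕ → ℕ → ℕ := fun k =>
    Nat.rec (fun _ => 0) (fun k z => Function.update z k (m z k)) k
  have hZsucc : ∀ k, Z (k + 1) = Function.update (Z k) k (m (Z k) k) := fun k => rfl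
  have hZ : ∀ k, ¬ SeqMeasurablySeparable (C (Z k) k) := by
    intro k
    induction k with
    | zero =>
      have : C (Z 0) 0 = fun n => range (f n) := by
        funext n
        simp [C]
      rwa [this]
    | succ k ih => rw [hZsucc]; exact hm _ _ ih
  let z : ℕ → ℕ := fun i => Z (i + 1) i
  have hZz : ∀ k, ∀ i < k, Z k i = z i := by
    intro k
    induction k with
    | zero => intro i hi; omega
    | succ k ih =>
      intro i hi
      rcases (Nat.lt_succ_iff.1 hi).lt_or_eq with hi | hi
      · rw [hZsucc, Function.update_of_ne hi.ne]
        exact ih i hi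
      · rw [hi]
  have hz : ∀ k, ¬ SeqMeasurablySeparable (C z k) := fun k => by
    rw [← hCcongr _ _ k (hZz k)]
    exact hZ k
  let p : ℕ → ℕ → ℕ := fun n i => z (Nat.pair n i)
  obtain ⟨a, b, hab⟩ : ∃ a b, f a (p a) ≠ f b (p b) := by
    by_contra! hne
    have : f 0 (p 0) ∈ ⋂ n, range (f n) := mem_iInter.2 fun n => ⟨p n, hne n 0⟩
    rw [h] at this
    exact this
  obtain ⟨U, V, hU, hV, haU, hbV, hUV⟩ := t2_separation hab
  have hcyl : ∀ n W, IsOpen W → f n (p n) ∈ W → ∃ K, ∀ k ≥ K, C z k n ⊆ W := by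
    intro n W hW hnW
    have hmem : f n ⁻¹' W ∈ nhds (p n) := (hf n).continuousAt.preimage_mem_nhds (hW.mem_nhds hnW)
    let : MetricSpace (ℕ → ℕ) := PiNat.metricSpaceNatNat
    obtain ⟨ε, hε, hball⟩ := Metric.mem_nhds_iff.1 hmem
    obtain ⟨N, hN⟩ : ∃ N : ℕ, (1 / 2 : ℝ) ^ N < ε := exists_pow_lt_of_lt_one hε (by norm_num)
    refine ⟨(∑ i ∈ Finset.range N, Nat.pair n i) + 1, fun k hk => ?_⟩
    rintro _ ⟨y, hy, rfl⟩
    apply hball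
    rw [Metric.mem_ball]
    refine lt_of_le_of_lt (PiNat.mem_cylinder_iff_dist_le.1 fun i hi => ?_) hN
    refine hy i (lt_of_lt_of_le (Nat.lt_succ_of_le ?_) hk)
    exact Finset.single_le_sum (f := fun i => Nat.pair n i) (fun _ _ => Nat.zero_le _)
      (Finset.mem_range.2 hi)
  obtain ⟨K, hK⟩ := hcyl a U hU haU
  obtain ⟨L, hL⟩ := hcyl b V hV hbV
  have hab' : a ≠ b := by
    rintro rfl
    exact hab rfl
  refine hz (max K L) ⟨fun n => if n = a then U else if n = b then V else univ, fun n => ?_,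
    fun n => ?_, ?_⟩
  · dsimp only
    split_ifs
    exacts [hU.measurableSet, hV.measurableSet, MeasurableSet.univ]
  · dsimp only
    split_ifs with h1 h2
    · rw [h1]; exact hK _ (le_max_left _ _)
    · rw [h2]; exact hL _ (le_max_right _ _)
    · exact subset_univ _
  · rw [eq_empty_iff_forall_notMem]
    intro x hx
    rw [mem_iInter] at hx
    have h1 := hx a
    have h2 := hx b
    simp only [if_true, hab'.symm, if_false] at h1 h2
    exact disjoint_left.1 hUV h1 h2

/-- **Novikov's separation theorem**: countably many analytic sets with empty intersection have
Borel supersets with empty intersection. -/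
theorem seqMeasurablySeparable_of_analyticSet {α : Type*} [TopologicalSpace α] [T2Space α]
    [MeasurableSpace α] [OpensMeasurableSpace α] {A : ℕ → Set α} (hA : ∀ n, AnalyticSet (A n))
    (h : ⋂ n, A n = ∅) : SeqMeasurablySeparable A := by
  by_cases hne : ∃ n, A n = ∅
  · obtain ⟨n, hn⟩ := hne
    refine ⟨fun k => if k = n then ∅ else univ, fun k => ?_, fun k => ?_, ?_⟩
    · dsimp only
      split_ifs
      exacts [MeasurableSet.empty, MeasurableSet.univ]
    · dsimp only
      split_ifs with hk
      · rw [hk, hn]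
      · exact subset_univ _
    · exact subset_empty_iff.1 ((iInter_subset _ n).trans (by simp))
  · push Not at hne
    have : ∀ n, ∃ f : (ℕ → ℕ) → α, Continuous f ∧ range f = A n := fun n =>
      by
      have := hA n
      rw [AnalyticSet] at this
      exact this.resolve_left (hne n).ne_empty
    choose f hfc hf using this
    have hfA : (fun n => range (f n)) = A := funext hf
    rw [← hfA]
    exact seqMeasurablySeparable_range hfc (by simpa only [hf] using h)

/-- If `q(x,·)` is bounded for every `x`, then the state space is the union of an increasing
sequence of `q`-bounded sets. -/
theorem exists_monotone_qBddOn_iUnion_eq_univ {X : Type*} [MeasurableSpace X]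
    [StandardBorelSpace X] {T0 : ℝ} {T1 : EReal} {q : X → ℝ → ℝ}
    (hq_meas : Measurable (Function.uncurry q))
    (hLB : ∀ x : X, ∃ M : ℝ, ∀ t : ℝ, T0 ≤ t → (t : EReal) < T1 → q x t ≤ M) :
    ∃ Y : ℕ → Set X, Monotone Y ∧ (∀ n, QBddOn q T0 T1 (Y n)) ∧ ⋃ n, Y n = univ := by
  let := upgradeStandardBorel X
  let A : ℕ → Set X := fun n => Prod.fst ''
    {p : X × ℝ | T0 ≤ p.2 ∧ (p.2 : EReal) < T1 ∧ (n : ℝ) < q p.1 p.2}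
  have hA : ∀ n, AnalyticSet (A n) := by
    intro n
    refine MeasurableSet.analyticSet_image ?_ measurable_fst
    exact (measurableSet_le measurable_const measurable_snd).inter
      ((measurableSet_lt (measurable_coe_real_ereal.comp measurable_snd) measurable_const).inter
        (measurableSet_lt measurable_const hq_meas))
  have hAi : ⋂ n, A n = ∅ := by
    rw [eq_empty_iff_forall_notMem]
    intro x hx
    obtain ⟨M, hM⟩ := hLB x
    obtain ⟨n, hn⟩ := exists_nat_ge M
    obtain ⟨⟨y, t⟩, ⟨h0, h1, h2⟩, rfl⟩ := mem_iInter.1 hx n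
    exact absurd (hM t h0 h1) (not_le.2 (hn.trans_lt h2))
  obtain ⟨B, hBm, hAB, hB⟩ := seqMeasurablySeparable_of_analyticSet hA hAi
  refine ⟨accumulate fun n => (B n)ᶜ, monotone_accumulate, fun n => ⟨?_, n, ?_⟩, ?_⟩
  · exact MeasurableSet.biUnion (to_countable _) fun k _ => (hBm k).compl
  · intro x hx t h0 h1
    obtain ⟨k, hk, hxk⟩ := mem_accumulate.1 hx
    by_contra! hlt
    exact hxk (hAB k ⟨(x, t), ⟨h0, h1, lt_of_le_of_lt (Nat.cast_le.2 hk) hlt⟩, rfl⟩)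
  · rw [iUnion_accumulate, ← compl_iInter, hB, compl_empty]

theorem AbsContOn.absolutelyContinuousOnInterval {f : ℝ → ℝ} {s : Set ℝ} (hf : AbsContOn f s)
    {a b : ℝ} (hab : uIcc a b ⊆ s) : AbsolutelyContinuousOnInterval f a b := by
  rw [absolutelyContinuousOnInterval_iff]
  intro ε hε
  obtain ⟨δ, hδ, h⟩ := hf ε hε
  refine ⟨δ, hδ, ?_⟩
  rintro ⟨n, I⟩ ⟨hI, hdisj⟩ hsum
  have hlt : ∀ i, max (I i).1 (I i).2 - min (I i).1 (I i).2 = dist (I i).1 (I i).2 := fun i => by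
    rw [Real.dist_eq, max_sub_min_eq_abs']
  have key := h n (fun i => min (I i).1 (I i).2) (fun i => max (I i).1 (I i).2) ?_ ?_ ?_
  · refine lt_of_le_of_lt (Finset.sum_le_sum fun i _ => ?_) key
    rw [Real.dist_eq]
    rcases le_total (I i).1 (I i).2 with hle | hle
    · simp only [min_eq_left hle, max_eq_right hle]
      rw [abs_sub_comm]
    · simp only [min_eq_right hle, max_eq_left hle]
      exact le_rfl
  · intro i hi
    obtain ⟨h1, h2⟩ := hI i (Finset.mem_range.2 hi)
    refine ⟨hab ?_, hab ?_, min_le_max⟩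
    · rcases min_choice (I i).1 (I i).2 with h | h <;> simp only [h] <;> assumption
    · rcases max_choice (I i).1 (I i).2 with h | h <;> simp only [h] <;> assumption
  · intro i hi j hj hij
    exact (hdisj (by simpa using hi) (by simpa using hj) hij).mono Ioo_subset_Ioc_self
      Ioo_subset_Ioc_self
  · simp only [hlt]
    exact hsum

/-- If `f` is absolutely continuous and its derivative is almost everywhere at least `-M f`, then
`t ↦ exp (M t) f t` is nondecreasing. -/
theorem AbsContOn.monotoneOn_exp_mul {f : ℝ → ℝ} {u s s' M : ℝ} (hf : AbsContOn f (Ioo u s'))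
    (hss' : s < s')
    (hf' : ∀ᵐ t ∂(volume.restrict (Ioo u s)), ∃ d, HasDerivAt f d t ∧ -M * f t ≤ d) :
    MonotoneOn (fun t => Real.exp (M * t) * f t) (Ioc u s) := by
  intro a ha b hb hab
  have hsub : uIcc a b ⊆ Ioo u s' := by
    rw [uIcc_of_le hab]
    exact fun t ht => ⟨ha.1.trans_le ht.1, (ht.2.trans hb.2).trans_lt hss'⟩
  have hexp : AbsolutelyContinuousOnInterval (fun t : ℝ => Real.exp (M * t)) a b :=
    ContDiffOn.absolutelyContinuousOnInterval (by fun_prop)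
  have hac := hexp.mul (hf.absolutelyContinuousOnInterval hsub)
  have hintegral := hac.integral_deriv_eq_sub
  have hnonneg : 0 ≤ ∫ x in a..b, deriv (fun t => Real.exp (M * t) * f t) x := by
    refine intervalIntegral.integral_nonneg_of_ae_restrict hab ?_
    have hres : volume.restrict (Icc a b) = volume.restrict (Ioo a b) :=
      Measure.restrict_congr_set Ioo_ae_eq_Icc.symm
    rw [hres]
    have hmono : Ioo a b ⊆ Ioo u s := Ioo_subset_Ioo ha.1.le hb.2
    filter_upwards [ae_mono (Measure.restrict_mono_set _ hmono) hf'] with t ht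
    obtain ⟨d, hd, hle⟩ := ht
    have h1 : HasDerivAt (fun t : ℝ => Real.exp (M * t)) (Real.exp (M * t) * M) t := by
      simpa using ((hasDerivAt_id t).const_mul M).exp
    have h2 := (h1.mul hd).deriv
    change 0 ≤ deriv ((fun t => Real.exp (M * t)) * f) t
    rw [h2]
    have := mul_le_mul_of_nonneg_left hle (Real.exp_pos (M * t)).le
    nlinarith
  have : 0 ≤ Real.exp (M * b) * f b - Real.exp (M * a) * f a := by
    exact hnonneg.trans_eq hintegral
  simpa using this

theorem MonotoneOn.sum_sub_le_of_disjoint {ι : Type*} {ρ : ℝ → ℝ} {a b : ι → ℝ}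
    (F : Finset ι) : ∀ {c d : ℝ}, c ≤ d → MonotoneOn ρ (Icc c d) →
    (∀ i ∈ F, c ≤ a i ∧ a i < b i ∧ b i ≤ d) →
    (∀ i ∈ F, ∀ j ∈ F, i ≠ j → Disjoint (Ioo (a i) (b i)) (Ioo (a j) (b j))) →
    ∑ i ∈ F, (ρ (b i) - ρ (a i)) ≤ ρ d - ρ c := by
  classical
  induction F using Finset.induction_on_max_value b with
  | empty =>
    intro c d hcd hρ _ _
    simpa using hρ ⟨le_rfl, hcd⟩ ⟨hcd, le_rfl⟩ hcd
  | insert i F hi hmax ih =>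
    intro c d hcd hρ hab hdisj
    rw [Finset.sum_insert hi]
    obtain ⟨h1, h2, h3⟩ := hab i (Finset.mem_insert_self _ _)
    have hsub : Icc c (a i) ⊆ Icc c d := Icc_subset_Icc_right (h2.le.trans h3)
    have key := ih h1 (hρ.mono hsub) (fun j hj => ?_) fun j hj k hk =>
      hdisj j (Finset.mem_insert_of_mem hj) k (Finset.mem_insert_of_mem hk)
    · have := hρ ⟨h1.trans h2.le, h3⟩ ⟨hcd, le_rfl⟩ h3
      linarith
    · obtain ⟨k1, k2, k3⟩ := hab j (Finset.mem_insert_of_mem hj)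
      refine ⟨k1, k2, ?_⟩
      have hne : i ≠ j := fun h => hi (h ▸ hj)
      have hd := hdisj i (Finset.mem_insert_self _ _) j (Finset.mem_insert_of_mem hj) hne
      rw [Ioo_disjoint_Ioo, min_eq_right (hmax j hj)] at hd
      rcases le_max_iff.1 hd with h | h
      · exact h
      · exact absurd k2 (not_lt.2 h)

theorem MonotoneOn.sum_abs_sub_le {ρ : ℝ → ℝ} {u s : ℝ} (hρ : MonotoneOn ρ (Ioc u s))
    (hpos : ∀ t ∈ Ioc u s, 0 ≤ ρ t) (hus : u < s) {n : ℕ} {a b : ℕ → ℝ}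
    (hab : ∀ i < n, a i ∈ Ioo u s ∧ b i ∈ Ioo u s ∧ a i ≤ b i)
    (hdisj : ∀ i < n, ∀ j < n, i ≠ j → Disjoint (Ioo (a i) (b i)) (Ioo (a j) (b j))) :
    ∑ i ∈ Finset.range n, |ρ (b i) - ρ (a i)| ≤ ρ s := by
  classical
  obtain ⟨c, hc, hcs, hca⟩ : ∃ c, u < c ∧ c ≤ s ∧ ∀ i < n, c ≤ a i := by
    have : ∀ m ≤ n, ∃ c, u < c ∧ c ≤ s ∧ ∀ i < m, c ≤ a i := by
      intro m
      induction m with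
      | zero => exact fun _ => ⟨s, hus, le_rfl, by simp⟩
      | succ m ih =>
        intro hm
        obtain ⟨c, h1, h2, h3⟩ := ih (by omega)
        refine ⟨min c (a m), lt_min h1 (hab m hm).1.1, (min_le_left _ _).trans h2, fun i hi => ?_⟩
        rcases (Nat.lt_succ_iff.1 hi).lt_or_eq with hi | rfl
        · exact (min_le_left _ _).trans (h3 i hi)
        · exact min_le_right _ _
    exact this n le_rfl
  have hsum : ∑ i ∈ Finset.range n, |ρ (b i) - ρ (a i)| =
      ∑ i ∈ (Finset.range n).filter (fun i => a i < b i), (ρ (b i) - ρ (a i)) := by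
    rw [Finset.sum_filter]
    refine Finset.sum_congr rfl fun i hi => ?_
    obtain ⟨h1, h2, h3⟩ := hab i (Finset.mem_range.1 hi)
    split_ifs with hlt
    · exact abs_of_nonneg (sub_nonneg.2 (hρ (Ioo_subset_Ioc_self h1) (Ioo_subset_Ioc_self h2) h3))
    · rw [le_antisymm h3 (not_lt.1 hlt), sub_self, abs_zero]
  rw [hsum]
  refine (MonotoneOn.sum_sub_le_of_disjoint _ hcs
    (hρ.mono fun t ht => ⟨hc.trans_le ht.1, ht.2⟩) (fun i hi => ?_) fun i hi j hj =>
    hdisj i (Finset.mem_range.1 (Finset.mem_filter.1 hi).1) j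
      (Finset.mem_range.1 (Finset.mem_filter.1 hj).1)).trans ?_
  · obtain ⟨hi, hlt⟩ := Finset.mem_filter.1 hi
    rw [Finset.mem_range] at hi
    exact ⟨hca i hi, hlt, (hab i hi).2.1.2.le⟩
  · exact sub_le_self _ (hpos c ⟨hc, hcs⟩)

theorem AbsContOn.of_monotoneOn_sub {g : ℝ → ℝ} {G : ℕ → ℝ → ℝ} {u s : ℝ} (hus : u < s)
    (hG : ∀ n, AbsContOn (G n) (Ioo u s))
    (hmono : ∀ n, MonotoneOn (fun t => g t - G n t) (Ioc u s))
    (hpos : ∀ n, ∀ t ∈ Ioc u s, 0 ≤ g t - G n t)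
    (hlim : Tendsto (fun n => g s - G n s) atTop (nhds 0)) : AbsContOn g (Ioo u s) := by
  intro ε hε
  obtain ⟨N, hN⟩ := (hlim.eventually (gt_mem_nhds (half_pos hε))).exists
  obtain ⟨δ, hδ, h⟩ := hG N (ε / 2) (half_pos hε)
  refine ⟨δ, hδ, fun n a b hab hdisj hsum => ?_⟩
  have h1 := h n a b hab hdisj hsum
  have h2 := (hmono N).sum_abs_sub_le (hpos N) hus hab hdisj
  have h3 : ∑ i ∈ Finset.range n, |g (b i) - g (a i)| ≤
      ∑ i ∈ Finset.range n, |G N (b i) - G N (a i)| +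
      ∑ i ∈ Finset.range n, |(g (b i) - G N (b i)) - (g (a i) - G N (a i))| := by
    rw [← Finset.sum_add_distrib]
    refine Finset.sum_le_sum fun i _ => ?_
    refine le_trans (le_of_eq ?_) (abs_add_le _ _)
    congr 1
    ring
  linarith

theorem AbsContOn.mul_of_bound {f g : ℝ → ℝ} {S : Set ℝ} {F G L : ℝ} (hf : AbsContOn f S)
    (hfb : ∀ t ∈ S, |f t| ≤ F) (hgb : ∀ t ∈ S, |g t| ≤ G) (hF : 0 ≤ F) (hG : 0 ≤ G) (hL : 0 ≤ L)
    (hg : ∀ a ∈ S, ∀ b ∈ S, a ≤ b → |g b - g a| ≤ L * (b - a)) :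
    AbsContOn (fun t => g t * f t) S := by
  intro ε hε
  obtain ⟨δ, hδ, h⟩ := hf (ε / (2 * (G + 1))) (by positivity)
  refine ⟨min δ (ε / (2 * (F * L + 1))), lt_min hδ (by positivity), fun n a b hab hdisj hsum => ?_⟩
  have h1 := h n a b hab hdisj (hsum.trans_le (min_le_left _ _))
  have h2 := hsum.trans_le (min_le_right _ _)
  have h3 : ∑ i ∈ Finset.range n, |g (b i) * f (b i) - g (a i) * f (a i)| ≤
      G * ∑ i ∈ Finset.range n, |f (b i) - f (a i)| +
      F * L * ∑ i ∈ Finset.range n, (b i - a i) := by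
    rw [Finset.mul_sum, Finset.mul_sum, ← Finset.sum_add_distrib]
    refine Finset.sum_le_sum fun i hi => ?_
    obtain ⟨ha, hb, hle⟩ := hab i (Finset.mem_range.1 hi)
    have heq : g (b i) * f (b i) - g (a i) * f (a i) =
        g (b i) * (f (b i) - f (a i)) + f (a i) * (g (b i) - g (a i)) := by ring
    rw [heq]
    refine (abs_add_le _ _).trans (add_le_add ?_ ?_)
    · rw [abs_mul]
      exact mul_le_mul_of_nonneg_right (hgb _ hb) (abs_nonneg _)
    · rw [abs_mul, mul_assoc]
      exact mul_le_mul (hfb _ ha) (hg _ ha _ hb hle) (abs_nonneg _) hF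
  have hS : 0 ≤ ∑ i ∈ Finset.range n, |f (b i) - f (a i)| := Finset.sum_nonneg fun _ _ => abs_nonneg _
  rw [lt_div_iff₀ (by positivity)] at h1 h2
  have hT : 0 ≤ ∑ i ∈ Finset.range n, (b i - a i) :=
    Finset.sum_nonneg fun i hi => sub_nonneg.2 (hab i (Finset.mem_range.1 hi)).2.2
  nlinarith

theorem AbsContOn.exp_mul {f : ℝ → ℝ} {u s F : ℝ} (hf : AbsContOn f (Ioo u s)) (M : ℝ)
    (hF : ∀ t ∈ Ioo u s, |f t| ≤ F) :
    AbsContOn (fun t => Real.exp (M * t) * f t) (Ioo u s) := by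
  have hK : ∀ t ∈ Ioo u s, Real.exp (M * t) ≤ Real.exp (|M| * max |u| |s|) := by
    intro t ht
    refine Real.exp_le_exp.2 ((le_abs_self _).trans ?_)
    rw [abs_mul]
    exact mul_le_mul_of_nonneg_left (abs_le_max_abs_abs ht.1.le ht.2.le) (abs_nonneg _)
  refine hf.mul_of_bound (F := max F 0) (G := Real.exp (|M| * max |u| |s|))
    (L := |M| * Real.exp (|M| * max |u| |s|)) (fun t ht => (hF t ht).trans (le_max_left _ _))
    (fun t ht => by rw [abs_of_pos (Real.exp_pos _)]; exact hK t ht) (le_max_right _ _)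
    (Real.exp_pos _).le (by positivity) ?_
  intro a ha b hb hab
  have := Convex.norm_image_sub_le_of_norm_hasDerivWithin_le (s := Ioo u s)
    (f := fun t => Real.exp (M * t)) (f' := fun t => Real.exp (M * t) * M)
    (C := |M| * Real.exp (|M| * max |u| |s|))
    (fun t _ => by simpa using (((hasDerivAt_id t).const_mul M).exp).hasDerivWithinAt)
    (fun t ht => by
      rw [norm_mul, Real.norm_eq_abs, Real.norm_eq_abs, abs_of_pos (Real.exp_pos _), mul_comm]
      exact mul_le_mul_of_nonneg_left (hK t ht) (abs_nonneg _)) (convex_Ioo u s) ha hb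
  rwa [Real.norm_eq_abs, Real.norm_eq_abs, abs_of_nonneg (sub_nonneg.2 hab)] at this

/-- If nonnegative nondecreasing functions decrease to zero in such a way that consecutive
differences are nondecreasing, then their derivatives tend to zero almost everywhere. -/
theorem ae_tendsto_deriv_zero_of_monotoneOn {ρ : ℕ → ℝ → ℝ} {u s : ℝ}
    (hmono : ∀ n, MonotoneOn (ρ n) (Ioc u s))
    (hdiff : ∀ n, MonotoneOn (fun t => ρ n t - ρ (n + 1) t) (Ioc u s))
    (hpos : ∀ n, ∀ t ∈ Ioc u s, 0 ≤ ρ n t) (hlim : Tendsto (fun n => ρ n s) atTop (nhds 0)) :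
    ∀ᵐ t ∂(volume.restrict (Ioo u s)), (∀ n, DifferentiableAt ℝ (ρ n) t) ∧
      Tendsto (fun n => deriv (ρ n) t) atTop (nhds 0) := by
  have hdiffble : ∀ᵐ t ∂(volume.restrict (Ioo u s)), ∀ n, DifferentiableAt ℝ (ρ n) t := by
    rw [ae_all_iff]
    intro n
    filter_upwards [((hmono n).mono Ioo_subset_Ioc_self).ae_differentiableWithinAt
      measurableSet_Ioo, ae_restrict_mem measurableSet_Ioo] with t ht hmem
    exact ht.differentiableAt (Ioo_mem_nhds hmem.1 hmem.2)
  have hnn : ∀ {f : ℝ → ℝ} {t : ℝ}, MonotoneOn f (Ioc u s) → t ∈ Ioo u s → 0 ≤ deriv f t := by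
    intro f t hf ht
    have h1 : 0 ≤ derivWithin f (Ioo u s) t := (hf.mono Ioo_subset_Ioc_self).derivWithin_nonneg
    rwa [derivWithin_of_isOpen isOpen_Ioo ht] at h1
  suffices h : ∀ᵐ t ∂(volume.restrict (Ioo u s)), Tendsto (fun n => deriv (ρ n) t) atTop (nhds 0) by
    filter_upwards [hdiffble, h] with t h1 h2 using ⟨h1, h2⟩
  refine ae_restrict_of_ae_restrict_inter_Ioo fun a b ha hb hab => ?_
  have hsub : Ioo a s ⊆ Ioo u s := Ioo_subset_Ioo_left ha.1.le
  have hsub' : Ioo u s ∩ Ioo a b ⊆ Ioo a s := fun t ht => ⟨ht.2.1, ht.1.2⟩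
  refine ae_mono (Measure.restrict_mono_set _ hsub') ?_
  have has : a ≤ s := ha.2.le
  have hIcc : uIcc a s ⊆ Ioc u s := by
    rw [uIcc_of_le has]
    exact fun t ht => ⟨ha.1.trans_le ht.1, ht.2⟩
  have hlint : ∀ n, ∫⁻ t in Ioo a s, ENNReal.ofReal (deriv (ρ n) t) ≤ ENNReal.ofReal (ρ n s) := by
    intro n
    have hm := (hmono n).mono hIcc
    have hii := hm.intervalIntegrable_deriv
    rw [intervalIntegrable_iff_integrableOn_Ioo_of_le has] at hii
    rw [← ofReal_integral_eq_lintegral_ofReal hii]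
    · refine ENNReal.ofReal_le_ofReal ?_
      have hmem := hm.intervalIntegral_deriv_mem_uIcc
      rw [intervalIntegral.integral_of_le has, integral_Ioc_eq_integral_Ioo,
        uIcc_of_le (sub_nonneg.2 (hm left_mem_uIcc right_mem_uIcc has))] at hmem
      exact hmem.2.trans (sub_le_self _ (hpos n a ⟨ha.1, has⟩))
    · filter_upwards [ae_restrict_mem measurableSet_Ioo] with t ht
      exact hnn (hmono n) (hsub ht)
  have hzero : ∫⁻ t in Ioo a s, ⨅ n, ENNReal.ofReal (deriv (ρ n) t) = 0 := by
    refine le_antisymm ?_ zero_le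
    have hlim' : Tendsto (fun n => ENNReal.ofReal (ρ n s)) atTop (nhds 0) := by
      simpa using ENNReal.tendsto_ofReal hlim
    refine ge_of_tendsto' hlim' fun n => le_trans (lintegral_mono fun t => ?_) (hlint n)
    exact iInf_le _ n
  rw [lintegral_eq_zero_iff (Measurable.iInf fun n => (measurable_deriv _).ennreal_ofReal)] at hzero
  filter_upwards [hzero, ae_mono (Measure.restrict_mono_set _ hsub) hdiffble,
    ae_restrict_mem measurableSet_Ioo] with t h0 hd ht
  have hanti : Antitone fun n => ENNReal.ofReal (deriv (ρ n) t) := by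
    refine antitone_nat_of_succ_le fun n => ENNReal.ofReal_le_ofReal ?_
    have h1 := hnn (hdiff n) (hsub ht)
    rw [deriv_fun_sub (hd n) (hd (n + 1))] at h1
    linarith
  have htend := tendsto_atTop_iInf hanti
  rw [show ⨅ n, ENNReal.ofReal (deriv (ρ n) t) = 0 from h0] at htend
  have := (ENNReal.tendsto_toReal ENNReal.zero_ne_top).comp htend
  refine this.congr fun n => ?_
  exact ENNReal.toReal_ofReal (hnn (hmono n) (hsub ht))

theorem ENNReal.eq_toReal_of_tendsto_of_monotone {G : ℕ → ENNReal} {g : ENNReal} {c : ℝ}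
    (hG : Monotone G) (hlim : Tendsto G atTop (nhds g))
    (hc : Tendsto (fun n => (G n).toReal) atTop (nhds c)) : c = g.toReal := by
  by_cases h : ∃ n, G n = ⊤
  · obtain ⟨n, hn⟩ := h
    have htop : ∀ m ≥ n, G m = ⊤ := fun m hm => top_unique (hn ▸ hG hm)
    have hg : g = ⊤ := tendsto_nhds_unique hlim
      (tendsto_const_nhds.congr' ((eventually_ge_atTop n).mono fun m hm => (htop m hm).symm))
    have hc0 : c = 0 := tendsto_nhds_unique hc
      (tendsto_const_nhds.congr' ((eventually_ge_atTop n).mono fun m hm => by simp [htop m hm]))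
    rw [hc0, hg, ENNReal.toReal_top]
  · push Not at h
    have hg : g = ENNReal.ofReal c := tendsto_nhds_unique hlim
      ((ENNReal.tendsto_ofReal hc).congr fun n => ENNReal.ofReal_toReal (h n))
    rw [hg, ENNReal.toReal_ofReal (ge_of_tendsto' hc fun n => ENNReal.toReal_nonneg)]

/-- The right-hand side of the forward equation is continuous along increasing sequences of sets,
provided that it converges at all. -/
theorem eq_neg_setIntegral_add_integral_of_tendsto {X : Type*} [MeasurableSpace X]
    {μ : Measure X} [IsFiniteMeasure μ] {q : X → ℝ} {κ : X → Measure X} {C : ℕ → Set X}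
    {B : Set X} {M D : ℝ} (hq : Measurable q) (hq0 : ∀ y, 0 ≤ q y) (hqM : ∀ y ∈ B, q y ≤ M)
    (hκ : ∀ A, MeasurableSet A → Measurable fun y => κ y A) (hκfin : ∀ y, κ y univ ≠ ⊤)
    (hC : Monotone C) (hCm : ∀ n, MeasurableSet (C n)) (hCB : ⋃ n, C n = B)
    (hD : Tendsto (fun n => -(∫ y in C n, q y ∂μ) + ∫ y, (κ y (C n)).toReal ∂μ) atTop (nhds D)) :
    D = -(∫ y in B, q y ∂μ) + ∫ y, (κ y B).toReal ∂μ := by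
  have hBm : MeasurableSet B := hCB ▸ MeasurableSet.iUnion hCm
  have hintegral : IntegrableOn q (⋃ n, C n) μ := by
    rw [hCB]
    refine Measure.integrableOn_of_bounded (M := M) (measure_ne_top _ _)
      hq.aestronglyMeasurable ?_
    filter_upwards [ae_restrict_mem hBm] with y hy
    rw [Real.norm_eq_abs, abs_of_nonneg (hq0 y)]
    exact hqM y hy
  have hloss := tendsto_setIntegral_of_monotone hCm hC hintegral
  rw [hCB] at hloss
  have hgain : ∀ A, MeasurableSet A → ∫ y, (κ y A).toReal ∂μ = (∫⁻ y, κ y A ∂μ).toReal :=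
    fun A hA => integral_toReal (hκ A hA).aemeasurable
      (Eventually.of_forall fun y => (measure_mono (subset_univ A)).trans_lt (hκfin y).lt_top)
  have hlint : Tendsto (fun n => ∫⁻ y, κ y (C n) ∂μ) atTop (nhds (∫⁻ y, κ y B ∂μ)) := by
    refine lintegral_tendsto_of_tendsto_of_monotone (fun n => (hκ _ (hCm n)).aemeasurable)
      (Eventually.of_forall fun y m n hmn => measure_mono (hC hmn))
      (Eventually.of_forall fun y => ?_)
    rw [← hCB]
    exact tendsto_measure_iUnion_atTop hC
  have hsum := hD.add hloss
  have hgainlim : Tendsto (fun n => (∫⁻ y, κ y (C n) ∂μ).toReal) atTop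
      (nhds (D + ∫ y in B, q y ∂μ)) :=
    hsum.congr fun n => by rw [hgain _ (hCm n)]; ring
  have hgainmono : Monotone fun n => ∫⁻ y, κ y (C n) ∂μ :=
    fun m n hmn => lintegral_mono fun y => measure_mono (hC hmn)
  have key := ENNReal.eq_toReal_of_tendsto_of_monotone hgainmono hlint hgainlim
  rw [hgain B hBm]
  linarith

theorem QBddOn.subset {X : Type*} [MeasurableSpace X] {q : X → ℝ → ℝ} {T0 : ℝ} {s : EReal}
    {B C : Set X} (hB : QBddOn q T0 s B) (hC : MeasurableSet C) (hCB : C ⊆ B) :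
    QBddOn q T0 s C :=
  ⟨hC, hB.2.imp fun _ hM y hy => hM y (hCB hy)⟩

theorem QBddOn.mono {X : Type*} [MeasurableSpace X] {q : X → ℝ → ℝ} {T0 : ℝ} {s s' : EReal}
    {B : Set X} (hB : QBddOn q T0 s' B) (hs : s ≤ s') : QBddOn q T0 s B :=
  ⟨hB.1, hB.2.imp fun _ hM y hy t h0 h1 => hM y hy t h0 (h1.trans_le hs)⟩

theorem fwdA_and_fwdB_of_fwdI_of_fwdII {X : Type*} [MeasurableSpace X] {T0 : ℝ} {T1 : EReal}
    {q : X → ℝ → ℝ} {qp : X → ℝ → Measure X} {P : ℝ → X → ℝ → Measure X}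
    (hI : FwdI q T0 T1 P) (hII : FwdII q qp T0 T1 P) : FwdA q T0 T1 P ∧ FwdB q qp T0 T1 P := by
  refine ⟨fun u hu huT x B hB => ⟨?_, fun s hus hsT => ?_⟩, fun u hu huT x B hB => ?_⟩
  · obtain ⟨s, hus, hsT⟩ := EReal.lt_iff_exists_real_btwn.1 huT
    exact (hI u hu s (by exact_mod_cast hus) hsT x B (hB.mono hsT.le)).1
  · exact (hI u hu s hus hsT x B (hB.mono hsT.le)).2
  · refine ae_restrict_of_ae_restrict_inter_Ioo fun a b ha hb hab => ?_
    have hsub : IooE u T1 ∩ Ioo a b ⊆ Ioo u b := fun t ht => ⟨ht.1.1, ht.2.2⟩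
    exact ae_mono (Measure.restrict_mono_set _ hsub)
      (hII u hu b hb.1 hb.2 x B (hB.mono hb.2.le))

theorem monotoneOn_exp_mul_of_qBddOn {X : Type*} [MeasurableSpace X] {T0 : ℝ} {T1 : EReal}
    {q : X → ℝ → ℝ} {qp : X → ℝ → Measure X} {P : ℝ → X → ℝ → Measure X}
    (hq_nonneg : ∀ x t, T0 ≤ t → (t : EReal) < T1 → 0 ≤ q x t)
    (hP : MemPhat T0 T1 P) (hA : FwdA q T0 T1 P) (hB : FwdB q qp T0 T1 P)
    {u s M : ℝ} (hu : T0 ≤ u) (hus : u < s) (hsT : (s : EReal) < T1) (x : X) {C : Set X}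
    (hC : QBddOn q T0 T1 C) (hM : ∀ y ∈ C, ∀ t : ℝ, T0 ≤ t → (t : EReal) < s → q y t ≤ M) :
    MonotoneOn (fun t => Real.exp (M * t) * (P u x t C).toReal) (Ioc u s) := by
  have huT : (u : EReal) < T1 := (EReal.coe_lt_coe_iff.2 hus).trans hsT
  obtain ⟨s', hss', hsT'⟩ := EReal.lt_iff_exists_real_btwn.1 hsT
  rw [EReal.coe_lt_coe_iff] at hss'
  refine ((hA u hu huT x C hC).2 s' (hus.trans hss') hsT').monotoneOn_exp_mul hss' ?_
  have hsub : Ioo u s ⊆ IooE u T1 := fun t ht =>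
    ⟨ht.1, (EReal.coe_lt_coe_iff.2 ht.2).trans hsT⟩
  filter_upwards [ae_mono (Measure.restrict_mono_set _ hsub) (hB u hu huT x C hC),
    ae_restrict_mem measurableSet_Ioo] with t ht htmem
  refine ⟨_, ht, ?_⟩
  have htT : (t : EReal) < T1 := (hsub htmem).2
  have ht0 : T0 ≤ t := hu.trans htmem.1.le
  have := hP.1 u x t hu htmem.1 htT
  have hle : ∫ y in C, q y t ∂(P u x t) ≤ M * (P u x t C).toReal := by
    have hnorm : ‖∫ y in C, q y t ∂(P u x t)‖ ≤ M * (P u x t).real C := by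
      refine norm_setIntegral_le_of_norm_le_const (measure_lt_top (P u x t) C) fun y hy => ?_
      rw [Real.norm_eq_abs, abs_of_nonneg (hq_nonneg y t ht0 htT)]
      exact hM y hy t ht0 (EReal.coe_lt_coe_iff.2 htmem.2)
    exact (le_abs_self _).trans hnorm
  have hge : 0 ≤ ∫ y, (qp y t C).toReal ∂(P u x t) := integral_nonneg fun _ => ENNReal.toReal_nonneg
  rw [fkeRHS]
  linarith

theorem fwdI_and_fwdII_of_fwdA_of_fwdB {X : Type*} [MeasurableSpace X] [StandardBorelSpace X]
    {T0 : ℝ} {T1 : EReal} {q : X → ℝ → ℝ} {qp : X → ℝ → Measure X}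
    (hq_nonneg : ∀ x t, T0 ≤ t → (t : EReal) < T1 → 0 ≤ q x t)
    (hq_meas : Measurable (Function.uncurry q))
    (hqp_total : ∀ x t, T0 ≤ t → (t : EReal) < T1 → qp x t univ = ENNReal.ofReal (q x t))
    (hqp_meas : ∀ B : Set X, MeasurableSet B → Measurable (fun p : X × ℝ => qp p.1 p.2 B))
    (hLB : ∀ x : X, ∃ M : ℝ, ∀ t : ℝ, T0 ≤ t → (t : EReal) < T1 → q x t ≤ M)
    {P : ℝ → X → ℝ → Measure X} (hP : MemPhat T0 T1 P)
    (hA : FwdA q T0 T1 P) (hB : FwdB q qp T0 T1 P) {u s : ℝ} (hu : T0 ≤ u) (hus : u < s)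
    (hsT : (s : EReal) < T1) (x : X) {B : Set X} (hBs : QBddOn q T0 s B) :
    (Tendsto (fun t => (P u x t B).toReal) (nhdsWithin u (Ioi u))
      (nhds (indicator B (fun _ => (1 : ℝ)) x)) ∧
      AbsContOn (fun t => (P u x t B).toReal) (Ioo u s)) ∧
    ∀ᵐ t ∂(volume.restrict (Ioo u s)),
      HasDerivAt (fun r => (P u x r B).toReal) (fkeRHS q qp P u x t B) t := by
  have huT : (u : EReal) < T1 := (EReal.coe_lt_coe_iff.2 hus).trans hsT
  obtain ⟨Y, hYmono, hYb, hYU⟩ := exists_monotone_qBddOn_iUnion_eq_univ hq_meas hLB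
  obtain ⟨hBm, M, hM⟩ := hBs
  have hltT : ∀ t ≤ s, (t : EReal) < T1 := fun t ht => (EReal.coe_le_coe_iff.2 ht).trans_lt hsT
  have hfin : ∀ t ∈ Ioc u s, IsFiniteMeasure (P u x t) := fun t ht =>
    hP.1 u x t hu ht.1 (hltT t ht.2)
  let F : Set X → ℝ → ℝ := fun C t => (P u x t C).toReal
  have hFlim : ∀ (C : ℕ → Set X) (C' : Set X), Monotone C → ⋃ n, C n = C' → ∀ t ∈ Ioc u s,
      Tendsto (fun n => F (C n) t) atTop (nhds (F C' t)) := by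
    rintro C _ hC rfl t ht
    have := hfin t ht
    exact (ENNReal.tendsto_toReal (measure_ne_top _ _)).comp (tendsto_measure_iUnion_atTop hC)
  have hYC : ∀ C : Set X, Monotone (fun n => C ∩ Y n) ∧ ⋃ n, C ∩ Y n = C := fun C =>
    ⟨fun m n hmn => inter_subset_inter_right C (hYmono hmn), by
      rw [← inter_iUnion, hYU, inter_univ]⟩
  have hQ : ∀ C, MeasurableSet C → ∀ n, QBddOn q T0 T1 (C ∩ Y n) := fun C hC n =>
    (hYb n).subset (hC.inter (hYb n).1) inter_subset_right
  have hgrow : ∀ C, MeasurableSet C → C ⊆ B →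
      MonotoneOn (fun t => Real.exp (M * t) * F C t) (Ioc u s) := by
    intro C hC hCB a ha b hb hab
    refine le_of_tendsto_of_tendsto' ((hFlim _ C (hYC C).1 (hYC C).2 a ha).const_mul _)
      ((hFlim _ C (hYC C).1 (hYC C).2 b hb).const_mul _) fun n => ?_
    exact monotoneOn_exp_mul_of_qBddOn hq_nonneg hP hA hB hu hus hsT x (hQ C hC n)
      (fun y hy => hM y (hCB hy.1)) ha hb hab
  have hFdiff : ∀ {C C' : Set X}, MeasurableSet C → C ⊆ C' → ∀ t ∈ Ioc u s,
      F C' t - F C t = F (C' \ C) t := by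
    intro C C' hC hCC' t ht
    have := hfin t ht
    have := measureReal_sdiff (μ := P u x t) hCC' hC
    exact this.symm
  let ρ : ℕ → ℝ → ℝ := fun n t => Real.exp (M * t) * F B t - Real.exp (M * t) * F (B ∩ Y n) t
  have hBn : ∀ n, MeasurableSet (B ∩ Y n) := fun n => hBm.inter (hYb n).1
  have hρ : ∀ n, ∀ t ∈ Ioc u s, ρ n t = Real.exp (M * t) * F (B \ (B ∩ Y n)) t := by
    intro n t ht
    rw [← hFdiff (hBn n) inter_subset_left t ht, mul_sub]
  have hρmono : ∀ n, MonotoneOn (ρ n) (Ioc u s) := fun n =>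
    (hgrow _ (hBm.diff (hBn n)) sdiff_subset).congr fun t ht => (hρ n t ht).symm
  have hρdiff : ∀ n, MonotoneOn (fun t => ρ n t - ρ (n + 1) t) (Ioc u s) := fun n =>
    (hgrow ((B ∩ Y (n + 1)) \ (B ∩ Y n)) ((hBn _).diff (hBn n))
      (sdiff_subset.trans inter_subset_left)).congr fun t ht => by
        dsimp only [ρ]
        rw [← hFdiff (hBn n) ((hYC B).1 n.le_succ) t ht]
        ring
  have hρpos : ∀ n, ∀ t ∈ Ioc u s, 0 ≤ ρ n t := fun n t ht => by
    rw [hρ n t ht]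
    exact mul_nonneg (Real.exp_pos _).le ENNReal.toReal_nonneg
  have hρlim : ∀ t ∈ Ioc u s, Tendsto (fun n => ρ n t) atTop (nhds 0) := fun t ht => by
    have := ((hFlim _ B (hYC B).1 (hYC B).2 t ht).const_mul (Real.exp (M * t))).const_sub
      (Real.exp (M * t) * F B t)
    simpa only [sub_self] using this
  have hs : s ∈ Ioc u s := ⟨hus, le_rfl⟩
  have hexpinv : ∀ f : ℝ → ℝ, (fun t => Real.exp (-M * t) * (Real.exp (M * t) * f t)) = f := by
    intro f
    funext t
    rw [← mul_assoc, ← Real.exp_add]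
    simp
  have hexpbd : ∀ C, MeasurableSet C → C ⊆ B → ∀ t ∈ Ioo u s,
      |Real.exp (M * t) * F C t| ≤ Real.exp (M * s) * F C s := by
    intro C hC hCB t ht
    rw [abs_of_nonneg (mul_nonneg (Real.exp_pos _).le ENNReal.toReal_nonneg)]
    exact hgrow C hC hCB (Ioo_subset_Ioc_self ht) hs ht.2.le
  refine ⟨⟨?_, ?_⟩, ?_⟩
  · have hunif : TendstoUniformlyOnFilter (fun n t => Real.exp (M * t) * F (B ∩ Y n) t)
        (fun t => Real.exp (M * t) * F B t) atTop (nhdsWithin u (Ioi u)) := by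
      rw [Metric.tendstoUniformlyOnFilter_iff]
      intro ε hε
      refine (((hρlim s hs).eventually (gt_mem_nhds hε)).prod_mk
        (Ioc_mem_nhdsGT hus)).mono ?_
      rintro ⟨n, t⟩ ⟨h1, h2⟩
      change |ρ n t| < ε
      rw [abs_of_nonneg (hρpos n t h2)]
      exact (hρmono n h2 hs h2.2).trans_lt h1
    have hexpu : ∀ k : ℝ, Tendsto (fun t : ℝ => Real.exp (k * t)) (nhdsWithin u (Ioi u))
        (nhds (Real.exp (k * u))) := fun k =>
      ((by fun_prop : Continuous fun t : ℝ => Real.exp (k * t)).tendsto u).mono_left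
        nhdsWithin_le_nhds
    have hlim := hunif.tendsto_of_eventually_tendsto
      (Eventually.of_forall fun n => (hexpu M).mul (hA u hu huT x _ (hQ B hBm n)).1)
      (ℓ := Real.exp (M * u) * indicator B (fun _ => (1 : ℝ)) x) (by
        refine Tendsto.const_mul _ ?_
        have := Monotone.tendsto_indicator (fun n => B ∩ Y n) (hYC B).1
          (fun _ => (1 : ℝ)) x
        rw [(hYC B).2] at this
        exact this.mono_right (pure_le_nhds _))
    have := (hexpu (-M)).mul hlim
    rw [hexpinv (F B)] at this
    convert this using 2
    rw [← mul_assoc, ← Real.exp_add]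
    simp
  · have hg : AbsContOn (fun t => Real.exp (M * t) * F B t) (Ioo u s) := by
      refine AbsContOn.of_monotoneOn_sub (G := fun n t => Real.exp (M * t) * F (B ∩ Y n) t) hus
        (fun n => ?_) hρmono hρpos (hρlim s hs)
      have hbd : ∀ t ∈ Ioo u s, |F (B ∩ Y n) t| ≤
          Real.exp (|M| * max |u| |s|) * (Real.exp (M * s) * F (B ∩ Y n) s) := by
        intro t ht
        have h1 := hexpbd _ (hBn n) inter_subset_left t ht
        rw [← congrFun (hexpinv (F (B ∩ Y n))) t, abs_mul, abs_of_pos (Real.exp_pos _)]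
        refine mul_le_mul (Real.exp_le_exp.2 ((le_abs_self _).trans ?_)) h1 (abs_nonneg _)
          (Real.exp_pos _).le
        rw [abs_mul, abs_neg]
        exact mul_le_mul_of_nonneg_left (abs_le_max_abs_abs ht.1.le ht.2.le) (abs_nonneg _)
      exact ((hA u hu huT x _ (hQ B hBm n)).2 s hus hsT).exp_mul M hbd
    have := hg.exp_mul (-M) (hexpbd B hBm Subset.rfl)
    rwa [hexpinv (F B)] at this
  · have hsub : Ioo u s ⊆ IooE u T1 := fun t ht => ⟨ht.1, hltT t ht.2.le⟩
    have hder : ∀ᵐ t ∂(volume.restrict (Ioo u s)), ∀ n,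
        HasDerivAt (F (B ∩ Y n)) (fkeRHS q qp P u x t (B ∩ Y n)) t :=
      ae_all_iff.2 fun n => ae_mono (Measure.restrict_mono_set _ hsub)
        (hB u hu huT x _ (hQ B hBm n))
    filter_upwards [ae_tendsto_deriv_zero_of_monotoneOn hρmono hρdiff hρpos (hρlim s hs), hder,
      ae_restrict_mem measurableSet_Ioo] with t ⟨hd, hlim⟩ hder ht
    have hexpd : ∀ k : ℝ, HasDerivAt (fun t : ℝ => Real.exp (k * t)) (Real.exp (k * t) * k) t :=
      fun k => by simpa using ((hasDerivAt_id t).const_mul k).exp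
    have hg : DifferentiableAt ℝ (fun t => Real.exp (M * t) * F B t) t := by
      have := (hd 0).add ((hexpd M).mul (hder 0)).differentiableAt
      refine this.congr_of_eventuallyEq (Eventually.of_forall fun r => ?_)
      simp [ρ]
    have hf : DifferentiableAt ℝ (F B) t := by
      have := (hexpd (-M)).differentiableAt.mul hg
      rw [← hexpinv (F B)]
      exact this
    have hderiv : ∀ n, deriv (ρ n) t =
        (Real.exp (M * t) * M * F B t + Real.exp (M * t) * deriv (F B) t) -
        (Real.exp (M * t) * M * F (B ∩ Y n) t +
          Real.exp (M * t) * fkeRHS q qp P u x t (B ∩ Y n)) := fun n =>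
      (((hexpd M).mul hf.hasDerivAt).sub ((hexpd M).mul (hder n))).deriv
    have htc := Ioo_subset_Ioc_self ht
    have htT := hltT t ht.2.le
    have ht0 : T0 ≤ t := hu.trans ht.1.le
    have hRlim : Tendsto (fun n => fkeRHS q qp P u x t (B ∩ Y n)) atTop
        (nhds (deriv (F B) t)) := by
      have h1 := ((hFlim _ B (hYC B).1 (hYC B).2 t htc).const_sub (F B t)).const_mul M
      have h2 := ((h1.sub (hlim.const_mul (Real.exp (-(M * t))))).add_const (deriv (F B) t))
      simp only [sub_self, mul_zero, zero_add] at h2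
      refine h2.congr fun n => ?_
      rw [hderiv n, Real.exp_neg]
      field_simp
      ring
    have := hfin t htc
    have heq := eq_neg_setIntegral_add_integral_of_tendsto (μ := P u x t) (q := fun y => q y t)
      (κ := fun y => qp y t) (hq_meas.comp measurable_prodMk_right)
      (fun y => hq_nonneg y t ht0 htT) (fun y hy => hM y hy t ht0 (EReal.coe_lt_coe_iff.2 ht.2))
      (fun A hA => (hqp_meas A hA).comp measurable_prodMk_right)
      (fun y => by rw [hqp_total y t ht0 htT]; exact ENNReal.ofReal_ne_top)
      (hYC B).1 hBn (hYC B).2 hRlim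
    have hres := hf.hasDerivAt
    rw [heq] at hres
    exact hres

theorem forward_properties_iff_ab_of_LB
    {X : Type*} [MeasurableSpace X] [StandardBorelSpace X]
    (T0 : ℝ) (T1 : EReal) (hT0 : 0 ≤ T0) (hT01 : (T0 : EReal) < T1)
    (q : X → ℝ → ℝ) (qp : X → ℝ → Measure X)
    (hq_nonneg : ∀ x t, T0 ≤ t → (t : EReal) < T1 → 0 ≤ q x t)
    (hq_meas : Measurable (Function.uncurry q))
    (hqp_self : ∀ x t, T0 ≤ t → (t : EReal) < T1 → qp x t {x} = 0)
    (hqp_total : ∀ x t, T0 ≤ t → (t : EReal) < T1 → qp x t Set.univ = ENNReal.ofReal (q x t))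
    (hqp_meas : ∀ B : Set X, MeasurableSet B → Measurable (fun p : X × ℝ => qp p.1 p.2 B))
    (hLB : ∀ x : X, ∃ M : ℝ, ∀ t : ℝ, T0 ≤ t → (t : EReal) < T1 → q x t ≤ M)
    (P : ℝ → X → ℝ → Measure X) (hP : MemPhat T0 T1 P)
    :
    (FwdI q T0 T1 P ∧ FwdII q qp T0 T1 P) ↔ (FwdA q T0 T1 P ∧ FwdB q qp T0 T1 P) := by
  constructor
  · rintro ⟨hI, hII⟩
    exact fwdA_and_fwdB_of_fwdI_of_fwdII hI hII
  · rintro ⟨hA, hB⟩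
    have key := fun u hu s hus hsT x B => fwdI_and_fwdII_of_fwdA_of_fwdB hq_nonneg hq_meas
      hqp_total hqp_meas hLB hP hA hB (u := u) (s := s) hu hus hsT x (B := B)
    exact ⟨fun u hu s hus hsT x B hBs => (key u hu s hus hsT x B hBs).1,
      fun u hu s hus hsT x B hBs => (key u hu s hus hsT x B hBs).2⟩
end
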